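/- arXiv:2408.06191 — 2 statements merged into one kernel-verified Lean document; each statement's English description precedes it below -/
import Mathlib

section
/- For all k, l ≥ 1 and f ∈ C_{k+l}, Harish-Chandra restriction is cocommutative: for all x ∈ gl_k(𝔽_q) and y ∈ gl_l(𝔽_q), (*R^{k+l}_{k,l} f)(x,y) = (*R^{k+l}_{l,k} f)(y,x); explicitly, q^{-kl} Σ_{u ∈ Mat_{k×l}(𝔽_q)} f([x u; 0 y]) = q^{-kl} Σ_{v ∈ Mat_{l×k}(𝔽_q)} f([y v; 0 x]). -/
open Matrix BigOperators

namespace HCPaper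

open scoped Classical

/-- `gl F n` : the additive group of `n × n` matrices over `F`. -/
abbrev gl (F : Type) (n : ℕ) := Matrix (Fin n) (Fin n) F

variable {F : Type} [Field F] [Fintype F] [DecidableEq F]

/-- Conjugation (adjoint) action of `GL_n(F)` on `gl_n(F)`. -/
def conjM {n : ℕ} (g : Matrix.GeneralLinearGroup (Fin n) F) (x : gl F n) : gl F n :=
  (g : Matrix (Fin n) (Fin n) F) * x * ((g⁻¹ : Matrix.GeneralLinearGroup (Fin n) F) : Matrix (Fin n) (Fin n) F)

/-- A function `f : gl_n(F) → ℂ` is invariant if it is constant on `GL_n(F)`-conjugacy orbits. -/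
def Invariant (n : ℕ) (f : gl F n → ℂ) : Prop :=
  ∀ (g : Matrix.GeneralLinearGroup (Fin n) F) (x : gl F n), f (conjM g x) = f x

/-- Invariance for functions on `gl_k(F) × gl_l(F)` under `GL_k(F) × GL_l(F)`. -/
def Invariant₂ (k l : ℕ) (h : gl F k × gl F l → ℂ) : Prop :=
  ∀ (g₁ : Matrix.GeneralLinearGroup (Fin k) F) (g₂ : Matrix.GeneralLinearGroup (Fin l) F)
    (x : gl F k) (y : gl F l), h (conjM g₁ x, conjM g₂ y) = h (x, y)

/-- Transport of matrices along an equality of sizes. -/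
def castM {m n : ℕ} (h : m = n) (x : gl F m) : gl F n :=
  Matrix.reindex (finCongr h) (finCongr h) x

/-- Transport of functions along an equality of sizes. -/
def castFun {m n : ℕ} (h : m = n) (f : gl F m → ℂ) : gl F n → ℂ :=
  fun x => f (castM h.symm x)

/-- The block upper-triangular matrix `[x u; 0 y]`, viewed in `gl_{k+l}(F)`. -/
def but (k l : ℕ) (x : gl F k) (u : Matrix (Fin k) (Fin l) F) (y : gl F l) : gl F (k + l) :=
  Matrix.reindex finSumFinEquiv finSumFinEquiv (Matrix.fromBlocks x u 0 y)

/-- The block lower-triangular matrix `[x 0; v y]`, viewed in `gl_{k+l}(F)`. -/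
def blt (k l : ℕ) (x : gl F k) (v : Matrix (Fin l) (Fin k) F) (y : gl F l) : gl F (k + l) :=
  Matrix.reindex finSumFinEquiv finSumFinEquiv (Matrix.fromBlocks x 0 v y)

/-- View a matrix in `gl_{k+l}(F)` as a `2 × 2`-block matrix. -/
def blk (k l : ℕ) (m : gl F (k + l)) : Matrix (Fin k ⊕ Fin l) (Fin k ⊕ Fin l) F :=
  Matrix.reindex finSumFinEquiv.symm finSumFinEquiv.symm m

/-- Membership in `P_{k,l}` : being block upper triangular with blocks of sizes `k, l`. -/
def IsBUT (k l : ℕ) (m : gl F (k + l)) : Prop := Matrix.toBlocks₂₁ (blk k l m) = 0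

/-- The projection `π : P_{k,l} → gl_k(F) × gl_l(F)` deleting the off-diagonal block. -/
def proj (k l : ℕ) (m : gl F (k + l)) : gl F k × gl F l :=
  (Matrix.toBlocks₁₁ (blk k l m), Matrix.toBlocks₂₂ (blk k l m))

/-- The order of the group `P^×_{k,l}` of invertible block upper-triangular matrices. -/
noncomputable def Pcard (F : Type) [Field F] [Fintype F] [DecidableEq F] (k l : ℕ) : ℕ :=
  Nat.card {g : Matrix.GeneralLinearGroup (Fin (k + l)) F //
    IsBUT k l (g : Matrix (Fin (k + l)) (Fin (k + l)) F)}

/-- Harish-Chandra restriction `*R^{k+l}_{k,l}`; by convention it is the identity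
(under the canonical identifications) when `k = 0` or `l = 0`. -/
noncomputable def HCres (k l : ℕ) (f : gl F (k + l) → ℂ) : gl F k × gl F l → ℂ :=
  if hk : k = 0 then fun p => f (castM (by omega) p.2)
  else if hl : l = 0 then fun p => f (castM (by omega) p.1)
  else fun p =>
    ((Fintype.card F : ℂ) ^ (k * l))⁻¹ * ∑ u : Matrix (Fin k) (Fin l) F, f (but k l p.1 u p.2)

/-- Harish-Chandra induction `R^{k+l}_{k,l}`; by convention it is the identity
(under the canonical identifications) when `k = 0` or `l = 0`. -/
noncomputable def HCind (k l : ℕ) (h : gl F k × gl F l → ℂ) : gl F (k + l) → ℂ :=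
  if hk : k = 0 then fun z => h (0, castM (by omega) z)
  else if hl : l = 0 then fun z => h (castM (by omega) z, 0)
  else fun z =>
    ((Pcard F k l : ℂ))⁻¹ *
      ∑ g : Matrix.GeneralLinearGroup (Fin (k + l)) F,
        if IsBUT k l (conjM g z) then h (proj k l (conjM g z)) else 0

/-- The hermitian inner product on `C_n`. -/
noncomputable def inn (n : ℕ) (f g : gl F n → ℂ) : ℂ :=
  ((Fintype.card (Matrix.GeneralLinearGroup (Fin n) F) : ℂ))⁻¹ *
    ∑ x : gl F n, f x * (starRingEnd ℂ) (g x)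

/-- The hermitian inner product on invariant functions on `gl_k(F) × gl_l(F)`. -/
noncomputable def inn₂ (k l : ℕ) (f g : gl F k × gl F l → ℂ) : ℂ :=
  ((Fintype.card (Matrix.GeneralLinearGroup (Fin k) F) *
      Fintype.card (Matrix.GeneralLinearGroup (Fin l) F) : ℂ))⁻¹ *
    ∑ p : gl F k × gl F l, f p * (starRingEnd ℂ) (g p)

/-- `f ∈ C_n` is pre-cuspidal if all proper Harish-Chandra restrictions of `f` vanish. -/
def PreCuspidal (n : ℕ) (f : gl F n → ℂ) : Prop :=
  ∀ (k l : ℕ), 1 ≤ k → 1 ≤ l → ∀ hkl : k + l = n, HCres k l (castFun hkl.symm f) = 0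

/-- The composite `R_{(n_1,…,n_r)} ∘ *R_{(n_1,…,n_r)}` of the iterated two-block
Harish-Chandra induction and restriction along the composition `(n_1,…,n_r)`. -/
noncomputable def RcompRes : (L : List ℕ) → (gl F L.sum → ℂ) → gl F L.sum → ℂ
  | [], f => f
  | (k :: L), f =>
      castFun (List.sum_cons).symm
        (HCind k L.sum fun p =>
          RcompRes L (fun y => HCres k L.sum (castFun List.sum_cons f) (p.1, y)) p.2)

/-- The duality operation `𝒟_n(f) = Σ_{(n_1,…,n_r) ⊨ n} (-1)^{n-r}
R_{(n_1,…,n_r)}(*R_{(n_1,…,n_r)} f)`, the sum over all compositions of `n`. -/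
noncomputable def Dual (n : ℕ) (f : gl F n → ℂ) : gl F n → ℂ :=
  ∑ c : Composition n,
    ((-1 : ℂ)) ^ (n - c.length) •
      castFun c.blocks_sum (RcompRes c.blocks (castFun c.blocks_sum.symm f))

/-- `C_n`, the subspace of invariant functions, as a `ℂ`-submodule of all functions. -/
noncomputable def InvSub (F : Type) [Field F] (n : ℕ) : Submodule ℂ (gl F n → ℂ) where
  carrier := {f | Invariant n f}
  add_mem' := by
    intro a b ha hb g x
    simp only [Pi.add_apply]
    rw [ha g x, hb g x]
  zero_mem' := by intro g x; rfl
  smul_mem' := by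
    intro c f hf g x
    simp only [Pi.smul_apply]
    rw [hf g x]

/-- `χ` is the character of a finite-dimensional complex representation of the
additive group `gl_n(F)`. -/
def IsChar (n : ℕ) (χ : gl F n → ℂ) : Prop :=
  ∃ V : FDRep ℂ (Multiplicative (gl F n)),
    ∀ x : gl F n, FDRep.character V (Multiplicative.ofAdd x) = χ x

/-- An invariant character of `gl_n(F)`. -/
def IsInvChar (n : ℕ) (χ : gl F n → ℂ) : Prop := IsChar n χ ∧ Invariant n χ

/-- A character of the additive group `gl_k(F) × gl_l(F)`. -/
def IsChar₂ (k l : ℕ) (χ : gl F k × gl F l → ℂ) : Prop :=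
  ∃ V : FDRep ℂ (Multiplicative (gl F k × gl F l)),
    ∀ p : gl F k × gl F l, FDRep.character V (Multiplicative.ofAdd p) = χ p

/-- An invariant character of `gl_k(F) × gl_l(F)`. -/
def IsInvChar₂ (k l : ℕ) (χ : gl F k × gl F l → ℂ) : Prop := IsChar₂ k l χ ∧ Invariant₂ k l χ

/-- An irreducible invariant character: a nonzero invariant character which is not
the sum of two nonzero invariant characters. -/
def IrrInvChar (n : ℕ) (χ : gl F n → ℂ) : Prop :=
  IsInvChar n χ ∧ χ ≠ 0 ∧
    ¬ ∃ χ₁ χ₂ : gl F n → ℂ, IsInvChar n χ₁ ∧ IsInvChar n χ₂ ∧ χ₁ ≠ 0 ∧ χ₂ ≠ 0 ∧ χ = χ₁ + χ₂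


section Helpers

open Polynomial

/-- Existence of a nondegenerate `F[X]`-balanced form on an `F[X]`-module. -/
def HasForm (F : Type) [Field F] (N : Type) [AddCommGroup N] [Module F[X] N] : Prop :=
  ∃ B : N → N → F, (∀ a a' b, B (a + a') b = B a b + B a' b) ∧
    (∀ a b b', B a (b + b') = B a b + B a b') ∧
    (∀ (c : F) a b, B ((C c : F[X]) • a) b = c * B a b) ∧
    (∀ (p : F[X]) a b, B (p • a) b = B a (p • b)) ∧
    ∀ a, (∀ b, B a b = 0) → a = 0

lemma HasForm.of_equiv {F : Type} [Field F] {N N' : Type} [AddCommGroup N] [Module F[X] N]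
    [AddCommGroup N'] [Module F[X] N'] (e : N ≃ₗ[F[X]] N') (h : HasForm F N') : HasForm F N := by
  obtain ⟨B, h1, h2, h3, h4, h5⟩ := h
  refine ⟨fun a b => B (e a) (e b), ?_, ?_, ?_, ?_, ?_⟩
  · intro a a' b; simp [h1]
  · intro a a' b; simp [h2]
  · intro a a' b; simp [h3]
  · intro a a' b; simp [h4]
  · intro a ha
    have := h5 (e a) (fun b => by simpa using ha (e.symm b))
    simpa using this

lemma HasForm.directSum {F : Type} [Field F] {ι : Type} [Fintype ι] (N : ι → Type)
    [∀ i, AddCommGroup (N i)] [∀ i, Module F[X] (N i)] (h : ∀ i, HasForm F (N i)) :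
    HasForm F (DirectSum ι N) := by
  choose B h1 h2 h3 h4 h5 using h
  refine ⟨fun a b => ∑ i, B i (a i) (b i), ?_, ?_, ?_, ?_, ?_⟩
  · intro a a' b; simp [h1, Finset.sum_add_distrib]
  · intro a a' b; simp [h2, Finset.sum_add_distrib]
  · intro c a b
    rw [Finset.mul_sum]
    exact Finset.sum_congr rfl fun i _ => by rw [DirectSum.smul_apply, h3]
  · intro p a b
    exact Finset.sum_congr rfl fun i _ => by rw [DirectSum.smul_apply, DirectSum.smul_apply, h4]
  · intro a ha
    refine DFinsupp.ext fun i => h5 i _ fun b => ?_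
    have := ha (DirectSum.of N i b)
    beta_reduce at this
    rw [Finset.sum_eq_single i] at this
    · simpa using this
    · intro j _ hj
      rw [DirectSum.of_eq_of_ne _ _ _ hj]
      have := h2 j (a j) 0 0
      simpa using this
    · simp

lemma HasForm.cyclic_monic {F : Type} [Field F] (g : F[X]) (hg : g.Monic) :
    HasForm F (F[X] ⧸ (Ideal.span {g})) := by
  have hs : Function.Surjective (Ideal.Quotient.mk (Ideal.span {g})) :=
    Ideal.Quotient.mk_surjective
  obtain ⟨lam, hlam⟩ : ∃ lam : F[X] ⧸ (Ideal.span {g}) → F,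
      ∀ p, lam (Ideal.Quotient.mk _ p) = (p %ₘ g).coeff (g.natDegree - 1) := by
    refine ⟨fun z => ((Function.surjInv hs z) %ₘ g).coeff (g.natDegree - 1), fun p => ?_⟩
    have : (Function.surjInv hs (Ideal.Quotient.mk _ p)) %ₘ g = p %ₘ g := by
      have h := Function.surjInv_eq hs (Ideal.Quotient.mk _ p)
      rw [Ideal.Quotient.eq, Ideal.mem_span_singleton] at h
      exact modByMonic_eq_of_dvd_sub hg h
    beta_reduce
    rw [this]
  have hadd : ∀ a b, lam (a + b) = lam a + lam b := by
    intro a b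
    obtain ⟨a, rfl⟩ := hs a
    obtain ⟨b, rfl⟩ := hs b
    rw [← map_add, hlam, hlam, hlam, add_modByMonic, coeff_add]
  have hsm : ∀ (p : F[X]) (a : F[X]), p • (Ideal.Quotient.mk (Ideal.span {g}) a) =
      Ideal.Quotient.mk (Ideal.span {g}) (p * a) := fun p a => rfl
  refine ⟨fun a b => lam (a * b), ?_, ?_, ?_, ?_, ?_⟩
  · intro a a' b; simp only [add_mul, hadd]
  · intro a a' b; simp only [mul_add, hadd]
  · intro c a b
    obtain ⟨a, rfl⟩ := hs a
    obtain ⟨b, rfl⟩ := hs b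
    simp only [hsm]
    rw [← map_mul, ← map_mul, hlam, hlam, mul_assoc, ← smul_eq_C_mul, smul_modByMonic, coeff_smul,
      smul_eq_mul]
  · intro p a b
    obtain ⟨a, rfl⟩ := hs a
    obtain ⟨b, rfl⟩ := hs b
    simp only [hsm]
    rw [← map_mul, ← map_mul]
    congr 2
    ring
  · intro a ha
    obtain ⟨a, rfl⟩ := hs a
    have hr : Ideal.Quotient.mk (Ideal.span {g}) a = Ideal.Quotient.mk (Ideal.span {g}) (a %ₘ g) := by
      rw [Ideal.Quotient.eq, Ideal.mem_span_singleton, modByMonic_eq_sub_mul_div]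
      simp
    rw [hr] at ha ⊢
    by_contra hne
    have h0 : a %ₘ g ≠ 0 := by
      intro h; rw [h] at hne; simp at hne
    have hg1 : g ≠ 1 := by
      rintro rfl; simp at h0
    have hlt := natDegree_modByMonic_lt a hg hg1
    set r := a %ₘ g with hrdef
    have := ha (Ideal.Quotient.mk _ (X ^ (g.natDegree - 1 - r.natDegree)))
    beta_reduce at this
    rw [← map_mul, hlam, (modByMonic_eq_self_iff hg).2] at this
    · have h2 : (r * X ^ (g.natDegree - 1 - r.natDegree)).coeff
          (r.natDegree + (g.natDegree - 1 - r.natDegree)) = r.leadingCoeff := by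
        rw [coeff_mul_X_pow]; rfl
      rw [show r.natDegree + (g.natDegree - 1 - r.natDegree) = g.natDegree - 1 by omega, this] at h2
      exact h0 (leadingCoeff_eq_zero.1 h2.symm)
    · apply degree_lt_degree
      rw [natDegree_mul h0 (by simp), natDegree_X_pow]
      omega

lemma HasForm.cyclic {F : Type} [Field F] (g : F[X]) (hg : g ≠ 0) :
    HasForm F (F[X] ⧸ (Ideal.span {g})) := by
  have h : Ideal.span {g} = Ideal.span {g * C g.leadingCoeff⁻¹} := by
    rw [Ideal.span_singleton_eq_span_singleton]
    refine associated_mul_unit_right _ _ ?_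
    rw [isUnit_C]
    simpa using hg
  rw [h]
  exact HasForm.cyclic_monic _ (monic_mul_leadingCoeff_inv hg)

/-- Every square matrix over a field is similar to its transpose. -/
lemma exists_similar_transpose {F : Type} [Field F] {n : Type} [Fintype n] [DecidableEq n]
    (M : Matrix n n F) :
    ∃ S T : Matrix n n F, S * T = 1 ∧ T * S = 1 ∧ Mᵀ = S * M * T := by
  have key : ∃ B : (n → F) → (n → F) → F, (∀ a a' b, B (a + a') b = B a b + B a' b) ∧
    (∀ a b b', B a (b + b') = B a b + B a b') ∧
    (∀ (c : F) a b, B (c • a) b = c * B a b) ∧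
    (∀ (c : F) a b, B a (c • b) = c * B a b) ∧
    (∀ a b, B (M *ᵥ a) b = B a (M *ᵥ b)) ∧
    ∀ a, (∀ b, B a b = 0) → a = 0 := by
    let φ : Module.End F (n → F) := Matrix.toLin' M
    have hfin : Module.Finite F[X] (Module.AEval' φ) := inferInstance
    have ht : Module.IsTorsion F[X] (Module.AEval' φ) :=
      Module.AEval.isTorsion_of_finiteDimensional F (n → F) φ
    obtain ⟨ι, _, p, hp, e, ⟨E⟩⟩ := Module.equiv_directSum_of_isTorsion ht
    have hF : HasForm F (Module.AEval' φ) :=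
      HasForm.of_equiv E (HasForm.directSum _ fun i =>
        HasForm.cyclic (p i ^ e i) (pow_ne_zero _ (hp i).ne_zero))
    obtain ⟨B, h1, h2, h3, h4, h5⟩ := hF
    let o := Module.AEval'.of φ
    have hC : ∀ (c : F) (a : n → F), o (c • a) = (C c : F[X]) • o a := by
      intro c a
      rw [map_smul]
      exact (Module.AEval.C_smul φ c (o a)).symm
    have hX : ∀ (a : n → F), o (M *ᵥ a) = (X : F[X]) • o a := by
      intro a
      rw [Module.AEval'.X_smul_of]
      simp [φ, o]
    refine ⟨fun a b => B (o a) (o b), ?_, ?_, ?_, ?_, ?_, ?_⟩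
    · intro a a' b; simp only [map_add, h1]
    · intro a a' b; simp only [map_add, h2]
    · intro c a b; simp only [hC, h3]
    · intro c a b; simp only [hC, ← h4, h3]
    · intro a b; simp only [hX, h4]
    · intro a ha
      have := h5 (o a) (fun b => by simpa using ha (o.symm b))
      simpa using this
  obtain ⟨B, h1, h2, h3, h3', h4, h5⟩ := key
  let L : (n → F) →ₗ[F] (n → F) →ₗ[F] F :=
    LinearMap.mk₂ F B h1 (fun c a b => h3 c a b) h2 (fun c a b => h3' c a b)
  let S : Matrix n n F := LinearMap.toMatrix₂' F L
  have hS : ∀ a b, B a b = a ⬝ᵥ S *ᵥ b := by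
    intro a b
    have : Matrix.toLinearMap₂' F S = L := by simp [S]
    rw [← Matrix.toLinearMap₂'_apply', this]
    rfl
  have hdet : S.det ≠ 0 := by
    intro h
    obtain ⟨v, hv, hv0⟩ := Matrix.exists_vecMul_eq_zero_iff.2 h
    refine hv (h5 v fun b => ?_)
    rw [hS, Matrix.dotProduct_mulVec, hv0, zero_dotProduct]
  have hu : IsUnit S.det := isUnit_iff_ne_zero.2 hdet
  have hMS : Mᵀ * S = S * M := by
    ext i j
    have := h4 (Pi.single i 1) (Pi.single j 1)
    rw [hS, hS] at this
    rw [Matrix.mulVec_mulVec, single_one_dotProduct, Matrix.mulVec_single_one,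
      Matrix.mulVec_single_one, Matrix.mulVec_single_one] at this
    simp only [Matrix.col_apply] at this
    rw [← this, Matrix.mul_apply]
    rfl
  refine ⟨S, S⁻¹, Matrix.mul_nonsing_inv _ hu, Matrix.nonsing_inv_mul _ hu, ?_⟩
  rw [← hMS, Matrix.mul_assoc, Matrix.mul_nonsing_inv _ hu, Matrix.mul_one]

lemma Invariant.reindex_eq {F : Type} [Field F] {n : ℕ} {f : gl F n → ℂ} (hf : Invariant n f)
    {m : Type} [Fintype m] [DecidableEq m] (e e' : m ≃ Fin n) (A A' P Q : Matrix m m F)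
    (hPQ : P * Q = 1) (hQP : Q * P = 1) (hA : A' = P * A * Q) :
    f (Matrix.reindex e' e' A') = f (Matrix.reindex e e A) := by
  let g : Matrix.GeneralLinearGroup (Fin n) F :=
    ⟨P.submatrix e'.symm e.symm, Q.submatrix e.symm e'.symm,
      by rw [Matrix.submatrix_mul_equiv, hPQ, Matrix.submatrix_one_equiv],
      by rw [Matrix.submatrix_mul_equiv, hQP, Matrix.submatrix_one_equiv]⟩
  rw [← hf g (Matrix.reindex e e A)]
  congr 1
  change _ = P.submatrix e'.symm e.symm * A.submatrix e.symm e.symm * Q.submatrix e.symm e'.symm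
  rw [Matrix.submatrix_mul_equiv, Matrix.submatrix_mul_equiv, hA]
  rfl

end Helpers

/-- Harish-Chandra restriction is cocommutative. -/
theorem HCres_cocomm (F : Type) [Field F] [Fintype F] [DecidableEq F]
    (k l : ℕ) (hk : 1 ≤ k) (hl : 1 ≤ l)
    (f : gl F (k + l) → ℂ) (hf : Invariant (k + l) f)
    (x : gl F k) (y : gl F l) :
    ((Fintype.card F : ℂ) ^ (k * l))⁻¹ *
        ∑ u : Matrix (Fin k) (Fin l) F, f (but k l x u y) =
      ((Fintype.card F : ℂ) ^ (k * l))⁻¹ *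
        ∑ v : Matrix (Fin l) (Fin k) F, f (castM (Nat.add_comm l k) (but l k y v x)) := by
  congr 1
  obtain ⟨a, a', haa, haa', hx⟩ := exists_similar_transpose x
  obtain ⟨b, b', hbb, hbb', hy⟩ := exists_similar_transpose y
  let Φ : Matrix (Fin k) (Fin l) F ≃ Matrix (Fin l) (Fin k) F :=
    { toFun := fun u => b' * uᵀ * a
      invFun := fun v => (b * v * a')ᵀ
      left_inv := by
        intro u
        beta_reduce
        rw [← Matrix.mul_assoc, ← Matrix.mul_assoc, hbb, Matrix.one_mul, Matrix.mul_assoc, haa,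
          Matrix.mul_one, Matrix.transpose_transpose]
      right_inv := by
        intro v
        beta_reduce
        rw [Matrix.transpose_transpose, ← Matrix.mul_assoc, ← Matrix.mul_assoc, hbb',
          Matrix.one_mul, Matrix.mul_assoc, haa', Matrix.mul_one] }
  refine Fintype.sum_equiv Φ _ _ fun u => ?_
  let e : Fin k ⊕ Fin l ≃ Fin (k + l) := finSumFinEquiv
  let e' : Fin k ⊕ Fin l ≃ Fin (k + l) :=
    ((Equiv.sumComm _ _).trans finSumFinEquiv).trans (finCongr (Nat.add_comm l k))
  have h1 : castM (Nat.add_comm l k) (but l k y (Φ u) x) =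
      Matrix.reindex e' e' (Matrix.fromBlocks x 0 (Φ u) y) := by
    ext i j
    simp only [castM, but, e', Matrix.reindex_apply, Matrix.submatrix_apply, Equiv.symm_trans_apply]
    generalize finSumFinEquiv.symm ((finCongr (Nat.add_comm l k)).symm i) = i'
    generalize finSumFinEquiv.symm ((finCongr (Nat.add_comm l k)).symm j) = j'
    rcases i' with i' | i' <;> rcases j' with j' | j' <;> rfl
  rw [h1]
  obtain ⟨S, T, hST, hTS, hM⟩ := exists_similar_transpose (Matrix.fromBlocks x u 0 y)
  have h2 := hf.reindex_eq e e _ _ S T hST hTS hM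
  have h3 := hf.reindex_eq e' e (Matrix.fromBlocks x 0 (Φ u) y)
    (Matrix.fromBlocks x u 0 y)ᵀ (Matrix.fromBlocks a 0 0 b) (Matrix.fromBlocks a' 0 0 b')
    (by simp [Matrix.fromBlocks_multiply, haa, hbb])
    (by simp [Matrix.fromBlocks_multiply, haa', hbb'])
    (by
      rw [Matrix.fromBlocks_transpose, Matrix.fromBlocks_multiply, Matrix.fromBlocks_multiply]
      have : b * (Φ u) * a' = uᵀ := by
        change b * (b' * uᵀ * a) * a' = uᵀ
        rw [← Matrix.mul_assoc, ← Matrix.mul_assoc, hbb, Matrix.one_mul, Matrix.mul_assoc, haa,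
          Matrix.mul_one]
      simp [this, hx, hy])
  exact h2.symm.trans h3

end HCPaper
end

section
/- Bialgebra compatibility of Harish-Chandra induction and restriction: let n₁, n₂ ≥ 1, f ∈ C_{n₁}, g ∈ C_{n₂}, n = n₁ + n₂, and s, t ≥ 0 with s + t = n. For nonnegative integers a, b, c, d with a + b = n₁, c + d = n₂, a + c = s, b + d = t, let F_{a,b,c,d} be the function on (gl_a(𝔽_q) × gl_c(𝔽_q)) × (gl_b(𝔽_q) × gl_d(𝔽_q)) defined by F_{a,b,c,d}((u,v),(w,z)) = (*R^{n₁}_{a,b} f)(u,w) · (*R^{n₂}_{c,d} g)(v,z). Then *R^n_{s,t}(R^n_{n₁,n₂}(f ⊠ g)) = Σ_{a,b,c,d} (R^s_{a,c} ⊗ R^t_{b,d})(F_{a,b,c,d}), the sum over all such quadruples (a,b,c,d), where (R^s_{a,c} ⊗ R^t_{b,d})(F) denotes the function on gl_s(𝔽_q) × gl_t(𝔽_q) obtained by applying Harish-Chandra induction R^s_{a,c} to F in its first pair of variables and R^t_{b,d} in its second pair of variables. -/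
open Matrix BigOperators

namespace HCPaper

open scoped Classical

variable {F : Type} [Field F] [Fintype F] [DecidableEq F]

set_option linter.unusedSectionVars false

section Iso

/-- Invertible matrices between possibly different index types. -/
structure MIso (F : Type) [Field F] (Y X : Type) [Fintype Y] [Fintype X] [DecidableEq Y]
    [DecidableEq X] where
  m : Matrix Y X F
  i : Matrix X Y F
  mi : m * i = 1
  im : i * m = 1

variable {X Y Z V : Type} [Fintype X] [Fintype Y] [Fintype Z] [Fintype V]
  [DecidableEq X] [DecidableEq Y] [DecidableEq Z] [DecidableEq V]

theorem MIso.ext' {M N : MIso F Y X} (h : M.m = N.m) : M = N := by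
  have hi : M.i = N.i := by
    calc M.i = M.i * (N.m * N.i) := by rw [N.mi, Matrix.mul_one]
      _ = N.i := by rw [← h, ← Matrix.mul_assoc, M.im, Matrix.one_mul]
  cases M; cases N; simp_all

noncomputable instance : Fintype (MIso F Y X) :=
  Fintype.ofInjective (fun M : MIso F Y X => M.m) (fun _ _ h => MIso.ext' h)

def MIso.comp (M : MIso F Z Y) (N : MIso F Y X) : MIso F Z X where
  m := M.m * N.m
  i := N.i * M.i
  mi := by
    rw [Matrix.mul_assoc, ← Matrix.mul_assoc N.m, N.mi, Matrix.one_mul, M.mi]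
  im := by
    rw [Matrix.mul_assoc, ← Matrix.mul_assoc M.i, M.im, Matrix.one_mul, N.im]

def MIso.symm (M : MIso F Y X) : MIso F X Y where
  m := M.i
  i := M.m
  mi := M.im
  im := M.mi

def MIso.cj (M : MIso F Y X) (z : Matrix X X F) : Matrix Y Y F := M.m * z * M.i

theorem MIso.comp_assoc (M : MIso F Z Y) (N : MIso F Y X) (L : MIso F X V) :
    (M.comp N).comp L = M.comp (N.comp L) := MIso.ext' (Matrix.mul_assoc _ _ _)

theorem MIso.comp_symm_cancel (M : MIso F Z Y) (N : MIso F Y X) :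
    (M.comp N).comp N.symm = M := MIso.ext' (by
  simp [MIso.comp, MIso.symm, Matrix.mul_assoc, N.mi])

theorem MIso.comp_symm_cancel' (M : MIso F Z Y) (N : MIso F X Y) :
    (M.comp N.symm).comp N = M := MIso.ext' (by
  simp [MIso.comp, MIso.symm, Matrix.mul_assoc, N.im])

theorem MIso.symm_comp_cancel (M : MIso F Z Y) (N : MIso F Y X) :
    M.symm.comp (M.comp N) = N := MIso.ext' (by
  simp [MIso.comp, MIso.symm, ← Matrix.mul_assoc, M.im])

theorem MIso.symm_comp_cancel' (M : MIso F Y Z) (N : MIso F Y X) :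
    M.comp (M.symm.comp N) = N := MIso.ext' (by
  simp [MIso.comp, MIso.symm, ← Matrix.mul_assoc, M.mi])

theorem MIso.symm_comp (M : MIso F Z Y) (N : MIso F Y X) :
    (M.comp N).symm = N.symm.comp M.symm := rfl

theorem MIso.symm_symm (M : MIso F Z Y) : M.symm.symm = M := rfl

theorem MIso.cj_comp (M : MIso F Z Y) (N : MIso F Y X) (z : Matrix X X F) :
    (M.comp N).cj z = M.cj (N.cj z) := by
  simp [MIso.comp, MIso.cj, Matrix.mul_assoc]

/-- composing on the right is a bijection -/
def MIso.rEquiv (N : MIso F Y X) : MIso F Z Y ≃ MIso F Z X where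
  toFun M := M.comp N
  invFun M := M.comp N.symm
  left_inv M := MIso.comp_symm_cancel M N
  right_inv M := MIso.comp_symm_cancel' M N

def MIso.lEquiv (N : MIso F Z Y) : MIso F Y X ≃ MIso F Z X where
  toFun M := N.comp M
  invFun M := N.symm.comp M
  left_inv M := MIso.symm_comp_cancel N M
  right_inv M := MIso.symm_comp_cancel' N M

def MIso.ofEquiv (F : Type) [Field F] (e : X ≃ Y) : MIso F Y X where
  m := (1 : Matrix X X F).submatrix e.symm id
  i := (1 : Matrix X X F).submatrix id e.symm
  mi := by
    rw [← Matrix.submatrix_mul _ _ _ _ _ Function.bijective_id]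
    simp
  im := by
    rw [← Matrix.submatrix_mul _ _ _ _ _ e.symm.bijective]
    simp

theorem MIso.ofEquiv_cj (e : X ≃ Y) (z : Matrix X X F) :
    (MIso.ofEquiv F e).cj z = Matrix.reindex e e z := by
  ext i j
  simp [MIso.cj, MIso.ofEquiv, Matrix.mul_apply, Matrix.one_apply]

theorem MIso.card_eq (M : MIso F Y X) : Fintype.card Y = Fintype.card X := by
  exact Matrix.square_of_invertible (R := F) M.m M.i M.mi M.im

variable {X₁ X₂ Y₁ Y₂ Z₁ Z₂ : Type} [Fintype X₁] [Fintype X₂] [Fintype Y₁] [Fintype Y₂]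
  [Fintype Z₁] [Fintype Z₂] [DecidableEq X₁] [DecidableEq X₂] [DecidableEq Y₁] [DecidableEq Y₂]
  [DecidableEq Z₁] [DecidableEq Z₂]

theorem tb21 (M : Matrix (Z₁ ⊕ Z₂) (Y₁ ⊕ Y₂) F) (N : Matrix (Y₁ ⊕ Y₂) (X₁ ⊕ X₂) F) :
    (M * N).toBlocks₂₁ = M.toBlocks₂₁ * N.toBlocks₁₁ + M.toBlocks₂₂ * N.toBlocks₂₁ := by
  ext i j
  simp [Matrix.mul_apply, Matrix.toBlocks₂₁, Matrix.toBlocks₁₁, Matrix.toBlocks₂₂]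

theorem tb11 (M : Matrix (Z₁ ⊕ Z₂) (Y₁ ⊕ Y₂) F) (N : Matrix (Y₁ ⊕ Y₂) (X₁ ⊕ X₂) F) :
    (M * N).toBlocks₁₁ = M.toBlocks₁₁ * N.toBlocks₁₁ + M.toBlocks₁₂ * N.toBlocks₂₁ := by
  ext i j
  simp [Matrix.mul_apply, Matrix.toBlocks₂₁, Matrix.toBlocks₁₁, Matrix.toBlocks₁₂]

theorem tb22 (M : Matrix (Z₁ ⊕ Z₂) (Y₁ ⊕ Y₂) F) (N : Matrix (Y₁ ⊕ Y₂) (X₁ ⊕ X₂) F) :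
    (M * N).toBlocks₂₂ = M.toBlocks₂₁ * N.toBlocks₁₂ + M.toBlocks₂₂ * N.toBlocks₂₂ := by
  ext i j
  simp [Matrix.mul_apply, Matrix.toBlocks₂₁, Matrix.toBlocks₁₂, Matrix.toBlocks₂₂]

theorem tb12 (M : Matrix (Z₁ ⊕ Z₂) (Y₁ ⊕ Y₂) F) (N : Matrix (Y₁ ⊕ Y₂) (X₁ ⊕ X₂) F) :
    (M * N).toBlocks₁₂ = M.toBlocks₁₁ * N.toBlocks₁₂ + M.toBlocks₁₂ * N.toBlocks₂₂ := by
  ext i j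
  simp [Matrix.mul_apply, Matrix.toBlocks₁₁, Matrix.toBlocks₁₂, Matrix.toBlocks₂₂]

def MIso.Upper (M : MIso F (Y₁ ⊕ Y₂) (X₁ ⊕ X₂)) : Prop :=
  M.m.toBlocks₂₁ = 0 ∧ M.i.toBlocks₂₁ = 0

theorem MIso.Upper.symm {M : MIso F (Y₁ ⊕ Y₂) (X₁ ⊕ X₂)} (h : M.Upper) : M.symm.Upper :=
  ⟨h.2, h.1⟩

theorem MIso.Upper.comp {M : MIso F (Z₁ ⊕ Z₂) (Y₁ ⊕ Y₂)} {N : MIso F (Y₁ ⊕ Y₂) (X₁ ⊕ X₂)}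
    (h : M.Upper) (h' : N.Upper) : (M.comp N).Upper := by
  constructor
  · simp [MIso.comp, tb21, h.1, h'.1]
  · simp [MIso.comp, tb21, h.2, h'.2]

theorem tb21_one : (1 : Matrix (X₁ ⊕ X₂) (X₁ ⊕ X₂) F).toBlocks₂₁ = 0 := by
  rw [← Matrix.fromBlocks_one, Matrix.toBlocks_fromBlocks₂₁]
theorem tb11_one : (1 : Matrix (X₁ ⊕ X₂) (X₁ ⊕ X₂) F).toBlocks₁₁ = 1 := by
  rw [← Matrix.fromBlocks_one, Matrix.toBlocks_fromBlocks₁₁]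
theorem tb22_one : (1 : Matrix (X₁ ⊕ X₂) (X₁ ⊕ X₂) F).toBlocks₂₂ = 1 := by
  rw [← Matrix.fromBlocks_one, Matrix.toBlocks_fromBlocks₂₂]

/-- diagonal blocks of an upper triangular iso -/
def MIso.d1 (M : MIso F (Y₁ ⊕ Y₂) (X₁ ⊕ X₂)) (h : M.Upper) : MIso F Y₁ X₁ where
  m := M.m.toBlocks₁₁
  i := M.i.toBlocks₁₁
  mi := by
    have := congrArg Matrix.toBlocks₁₁ M.mi
    simpa [tb11, h.2, tb11_one] using this
  im := by
    have := congrArg Matrix.toBlocks₁₁ M.im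
    simpa [tb11, h.1, tb11_one] using this

def MIso.d2 (M : MIso F (Y₁ ⊕ Y₂) (X₁ ⊕ X₂)) (h : M.Upper) : MIso F Y₂ X₂ where
  m := M.m.toBlocks₂₂
  i := M.i.toBlocks₂₂
  mi := by
    have := congrArg Matrix.toBlocks₂₂ M.mi
    simpa [tb22, h.1, tb22_one] using this
  im := by
    have := congrArg Matrix.toBlocks₂₂ M.im
    simpa [tb22, h.2, tb22_one] using this

/-- upper triangular iso with given blocks -/
def MIso.mk3 (l : MIso F Y₁ X₁) (k : MIso F Y₂ X₂) (v : Matrix Y₁ X₂ F) :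
    MIso F (Y₁ ⊕ Y₂) (X₁ ⊕ X₂) where
  m := Matrix.fromBlocks l.m v 0 k.m
  i := Matrix.fromBlocks l.i (-(l.i * v * k.i)) 0 k.i
  mi := by
    simp [Matrix.fromBlocks_multiply, ← Matrix.mul_assoc, l.mi, k.mi]
  im := by
    simp [Matrix.fromBlocks_multiply, Matrix.mul_assoc, l.im, k.im]

theorem MIso.mk3_upper (l : MIso F Y₁ X₁) (k : MIso F Y₂ X₂) (v : Matrix Y₁ X₂ F) :
    (MIso.mk3 l k v).Upper := ⟨by simp [MIso.mk3], by simp [MIso.mk3]⟩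

def upperEquiv : {M : MIso F (Y₁ ⊕ Y₂) (X₁ ⊕ X₂) // M.Upper} ≃
    (MIso F Y₁ X₁ × MIso F Y₂ X₂) × Matrix Y₁ X₂ F where
  toFun M := ((M.1.d1 M.2, M.1.d2 M.2), M.1.m.toBlocks₁₂)
  invFun p := ⟨MIso.mk3 p.1.1 p.1.2 p.2, MIso.mk3_upper _ _ _⟩
  left_inv M := by
    apply Subtype.ext
    apply MIso.ext'
    have := Matrix.fromBlocks_toBlocks M.1.m
    rw [M.2.1] at this
    simpa [MIso.mk3, MIso.d1, MIso.d2] using this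
  right_inv p := by
    obtain ⟨⟨l, k⟩, v⟩ := p
    simp [MIso.mk3, MIso.d1, MIso.d2]

theorem mk3_cj (l : MIso F Y₁ X₁) (k : MIso F Y₂ X₂) (v : Matrix Y₁ X₂ F)
    (x : Matrix X₁ X₁ F) (y : Matrix X₂ X₂ F) (u : Matrix X₁ X₂ F) :
    (MIso.mk3 l k v).cj (Matrix.fromBlocks x u 0 y) =
      Matrix.fromBlocks (l.cj x) (l.m * u * k.i + (v * y * k.i - l.m * x * (l.i * v * k.i)))
        0 (k.cj y) := by
  simp [MIso.mk3, MIso.cj, Matrix.fromBlocks_multiply, Matrix.add_mul, Matrix.mul_assoc]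
  abel

/-- the bijection of the off-diagonal blocks -/
def offEquiv (l : MIso F Y₁ X₁) (k : MIso F Y₂ X₂) : Matrix X₁ X₂ F ≃ Matrix Y₁ Y₂ F where
  toFun u := l.m * u * k.i
  invFun u := l.i * u * k.m
  left_inv u := by
    simp only [Matrix.mul_assoc, k.im, Matrix.mul_one]
    rw [← Matrix.mul_assoc, l.im, Matrix.one_mul]
  right_inv u := by
    simp only [Matrix.mul_assoc, k.mi, Matrix.mul_one]
    rw [← Matrix.mul_assoc, l.mi, Matrix.one_mul]

theorem sum_mk3_cj (l : MIso F Y₁ X₁) (k : MIso F Y₂ X₂) (v : Matrix Y₁ X₂ F)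
    (x : Matrix X₁ X₁ F) (y : Matrix X₂ X₂ F) (Φ : Matrix (Y₁ ⊕ Y₂) (Y₁ ⊕ Y₂) F → ℂ) :
    ∑ u : Matrix X₁ X₂ F, Φ ((MIso.mk3 l k v).cj (Matrix.fromBlocks x u 0 y)) =
      ∑ u : Matrix Y₁ Y₂ F, Φ (Matrix.fromBlocks (l.cj x) u 0 (k.cj y)) := by
  apply Fintype.sum_equiv ((offEquiv l k).trans
    (Equiv.addRight (v * y * k.i - l.m * x * (l.i * v * k.i))))
  intro u
  rw [mk3_cj]
  rfl

end Iso

section Count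

variable {A B C D : Type} [Fintype A] [Fintype B] [Fintype C] [Fintype D]
  [DecidableEq A] [DecidableEq B] [DecidableEq C] [DecidableEq D]

/-- the shuffle of the blocks -/
def sg (F : Type) [Field F] (A B C D : Type) [Fintype A] [Fintype B] [Fintype C] [Fintype D]
    [DecidableEq A] [DecidableEq B] [DecidableEq C] [DecidableEq D] :
    MIso F ((A ⊕ B) ⊕ (C ⊕ D)) ((A ⊕ C) ⊕ (B ⊕ D)) :=
  MIso.ofEquiv F (Equiv.sumSumSumComm A C B D)

theorem sh21 (l : Matrix (A ⊕ C) (A ⊕ C) F) (v : Matrix (A ⊕ C) (B ⊕ D) F)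
    (k : Matrix (B ⊕ D) (B ⊕ D) F) :
    (Matrix.reindex (Equiv.sumSumSumComm A C B D) (Equiv.sumSumSumComm A C B D)
      (Matrix.fromBlocks l v 0 k)).toBlocks₂₁ =
    Matrix.fromBlocks l.toBlocks₂₁ v.toBlocks₂₁ 0 k.toBlocks₂₁ := by
  ext (i | i) (j | j) <;> rfl

theorem sh11 (l : Matrix (A ⊕ C) (A ⊕ C) F) (v : Matrix (A ⊕ C) (B ⊕ D) F)
    (k : Matrix (B ⊕ D) (B ⊕ D) F) :
    (Matrix.reindex (Equiv.sumSumSumComm A C B D) (Equiv.sumSumSumComm A C B D)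
      (Matrix.fromBlocks l v 0 k)).toBlocks₁₁ =
    Matrix.fromBlocks l.toBlocks₁₁ v.toBlocks₁₁ 0 k.toBlocks₁₁ := by
  ext (i | i) (j | j) <;> rfl

theorem sh22 (l : Matrix (A ⊕ C) (A ⊕ C) F) (v : Matrix (A ⊕ C) (B ⊕ D) F)
    (k : Matrix (B ⊕ D) (B ⊕ D) F) :
    (Matrix.reindex (Equiv.sumSumSumComm A C B D) (Equiv.sumSumSumComm A C B D)
      (Matrix.fromBlocks l v 0 k)).toBlocks₂₂ =
    Matrix.fromBlocks l.toBlocks₂₂ v.toBlocks₂₂ 0 k.toBlocks₂₂ := by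
  ext (i | i) (j | j) <;> rfl

theorem fb_zero {X₁ X₂ Y₁ Y₂ : Type} (a : Matrix X₁ Y₁ F) (b : Matrix X₁ Y₂ F)
    (c : Matrix X₂ Y₁ F) (d : Matrix X₂ Y₂ F) :
    Matrix.fromBlocks a b c d = 0 ↔ a = 0 ∧ b = 0 ∧ c = 0 ∧ d = 0 := by
  rw [← Matrix.fromBlocks_zero, Matrix.fromBlocks_inj]

/-- splitting a matrix into four blocks -/
def blockEquiv {X₁ X₂ Y₁ Y₂ : Type} : Matrix (X₁ ⊕ X₂) (Y₁ ⊕ Y₂) F ≃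
    Matrix X₂ Y₁ F × Matrix X₁ Y₂ F × Matrix X₁ Y₁ F × Matrix X₂ Y₂ F where
  toFun M := (M.toBlocks₂₁, M.toBlocks₁₂, M.toBlocks₁₁, M.toBlocks₂₂)
  invFun p := Matrix.fromBlocks p.2.2.1 p.2.1 p.1 p.2.2.2
  left_inv M := Matrix.fromBlocks_toBlocks M
  right_inv p := by simp

theorem sum_blocks (G : Matrix A B F → Matrix C D F → ℂ) :
    ∑ u : Matrix (A ⊕ C) (B ⊕ D) F, (if u.toBlocks₂₁ = 0 then G u.toBlocks₁₁ u.toBlocks₂₂ else 0) =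
      (Fintype.card F : ℂ) ^ (Fintype.card A * Fintype.card D) * ∑ u₁, ∑ u₂, G u₁ u₂ := by
  refine (Fintype.sum_equiv blockEquiv _ (fun p : Matrix C B F × Matrix A D F × Matrix A B F ×
    Matrix C D F => if p.1 = 0 then G p.2.2.1 p.2.2.2 else 0) (fun u => rfl)).trans ?_
  rw [Fintype.sum_prod_type]
  rw [Finset.sum_eq_single 0 (by
    intro b _ hb
    simp [hb]) (by simp)]
  simp only [if_true]
  rw [Fintype.sum_prod_type]
  simp only [Finset.sum_const, Finset.card_univ, nsmul_eq_mul, Fintype.sum_prod_type]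
  congr 1
  have : Fintype.card (Matrix A D F) = Fintype.card F ^ (Fintype.card A * Fintype.card D) := by
    rw [show Fintype.card (Matrix A D F) = Fintype.card (A → D → F) from
      Fintype.card_congr (Equiv.refl _)]
    simp [← pow_mul, mul_comm]
  rw [this]; push_cast; rfl

theorem card_mat : Fintype.card (Matrix A D F) = Fintype.card F ^ (Fintype.card A * Fintype.card D) := by
  rw [show Fintype.card (Matrix A D F) = Fintype.card (A → D → F) from
      Fintype.card_congr (Equiv.refl _)]
  simp [← pow_mul, mul_comm]

/-- number of upper triangular automorphisms -/
noncomputable def UC (F : Type) [Field F] (X₁ X₂ : Type) [Fintype X₁] [Fintype X₂]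
    [DecidableEq X₁] [DecidableEq X₂] : ℕ :=
  Nat.card {M : MIso F (X₁ ⊕ X₂) (X₁ ⊕ X₂) // M.Upper}

def HW (F : Type) [Field F] (A B C D : Type) [Fintype A] [Fintype B] [Fintype C] [Fintype D]
    [DecidableEq A] [DecidableEq B] [DecidableEq C] [DecidableEq D] : Type :=
  {h : MIso F ((A ⊕ C) ⊕ (B ⊕ D)) ((A ⊕ C) ⊕ (B ⊕ D)) //
    h.Upper ∧ ((sg F A B C D).comp (h.comp (sg F A B C D).symm)).Upper}

theorem conj_m {X Y : Type} [Fintype X] [Fintype Y] [DecidableEq X] [DecidableEq Y]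
    (e : X ≃ Y) (h : MIso F X X) :
    ((MIso.ofEquiv F e).comp (h.comp (MIso.ofEquiv F e).symm)).m = Matrix.reindex e e h.m := by
  rw [← MIso.ofEquiv_cj]
  simp [MIso.comp, MIso.symm, MIso.cj, Matrix.mul_assoc]

theorem conj_i {X Y : Type} [Fintype X] [Fintype Y] [DecidableEq X] [DecidableEq Y]
    (e : X ≃ Y) (h : MIso F X X) :
    ((MIso.ofEquiv F e).comp (h.comp (MIso.ofEquiv F e).symm)).i = Matrix.reindex e e h.i := by
  rw [← MIso.ofEquiv_cj]
  simp [MIso.comp, MIso.symm, MIso.cj]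

theorem conj_mk3_upper (l : MIso F (A ⊕ C) (A ⊕ C)) (k : MIso F (B ⊕ D) (B ⊕ D))
    (v : Matrix (A ⊕ C) (B ⊕ D) F) :
    ((sg F A B C D).comp ((MIso.mk3 l k v).comp (sg F A B C D).symm)).Upper ↔
      (l.Upper ∧ k.Upper) ∧ v.toBlocks₂₁ = 0 := by
  unfold MIso.Upper sg
  rw [conj_m, conj_i]
  simp only [MIso.mk3]
  rw [sh21, sh21, fb_zero, fb_zero]
  constructor
  · rintro ⟨⟨h1, h2, -, h3⟩, h4, -, -, h5⟩
    exact ⟨⟨⟨h1, h4⟩, h3, h5⟩, h2⟩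
  · rintro ⟨⟨⟨h1, h4⟩, h3, h5⟩, h2⟩
    refine ⟨⟨h1, h2, rfl, h3⟩, h4, ?_, rfl, h5⟩
    have : (l.i * v * k.i).toBlocks₂₁ = 0 := by
      simp [tb21, h4, h2, h5]
    ext i j
    have := congrFun (congrFun this i) j
    simp [Matrix.toBlocks₂₁] at this ⊢
    exact this

def HWEquiv : HW F A B C D ≃ ({l : MIso F (A ⊕ C) (A ⊕ C) // l.Upper} ×
    {k : MIso F (B ⊕ D) (B ⊕ D) // k.Upper}) × {v : Matrix (A ⊕ C) (B ⊕ D) F // v.toBlocks₂₁ = 0} :=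
  (Equiv.subtypeSubtypeEquivSubtypeInter _ _).symm.trans <|
  (Equiv.subtypeEquiv (q := fun p : (MIso F (A ⊕ C) (A ⊕ C) × MIso F (B ⊕ D) (B ⊕ D)) ×
      Matrix (A ⊕ C) (B ⊕ D) F => (p.1.1.Upper ∧ p.1.2.Upper) ∧ p.2.toBlocks₂₁ = 0)
    upperEquiv (by
      intro M
      rw [← conj_mk3_upper]
      have : MIso.mk3 (upperEquiv M).1.1 (upperEquiv M).1.2 (upperEquiv M).2 = M.1 :=
        congrArg Subtype.val (upperEquiv.symm_apply_apply M)
      rw [this])).trans <|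
  (Equiv.subtypeProdEquivProd (p := fun p : (MIso F (A ⊕ C) (A ⊕ C) × MIso F (B ⊕ D) (B ⊕ D)) =>
    p.1.Upper ∧ p.2.Upper) (q := fun v : Matrix (A ⊕ C) (B ⊕ D) F => v.toBlocks₂₁ = 0)).trans
  (Equiv.prodCongr Equiv.subtypeProdEquivProd (Equiv.refl _))

theorem card_v : (Nat.card {v : Matrix (A ⊕ C) (B ⊕ D) F // v.toBlocks₂₁ = 0} : ℂ) =
    (Fintype.card F : ℂ) ^ (Fintype.card A * Fintype.card D) *
    ((Fintype.card F : ℂ) ^ (Fintype.card A * Fintype.card B) *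
      (Fintype.card F : ℂ) ^ (Fintype.card C * Fintype.card D)) := by
  have := sum_blocks (A := A) (B := B) (C := C) (D := D) (F := F) (fun _ _ => 1)
  simp only [Finset.sum_boole, Finset.sum_const, Finset.card_univ, card_mat, nsmul_eq_mul,
    mul_one] at this
  rw [Nat.card_eq_fintype_card, Fintype.card_subtype]
  convert this using 1
  push_cast
  rfl

theorem card_HW : (Nat.card (HW F A B C D) : ℂ) = (UC F A C : ℂ) * UC F B D *
    ((Fintype.card F : ℂ) ^ (Fintype.card A * Fintype.card D) *
    ((Fintype.card F : ℂ) ^ (Fintype.card A * Fintype.card B) *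
      (Fintype.card F : ℂ) ^ (Fintype.card C * Fintype.card D))) := by
  rw [Nat.card_congr HWEquiv, Nat.card_prod, Nat.card_prod, ← card_v]
  push_cast
  rfl

variable {S T N₁ N₂ : Type} [Fintype S] [Fintype T] [Fintype N₁] [Fintype N₂]
  [DecidableEq S] [DecidableEq T] [DecidableEq N₁] [DecidableEq N₂]

/-- relative position of `M` is that of the quadruple, as witnessed by `q` -/
def Good (M : MIso F (N₁ ⊕ N₂) (S ⊕ T)) (q : MIso F ((A ⊕ C) ⊕ (B ⊕ D)) (S ⊕ T)) : Prop :=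
  q.Upper ∧ (M.comp (q.symm.comp (sg F A B C D).symm)).Upper

theorem card_good (M : MIso F (N₁ ⊕ N₂) (S ⊕ T)) (q₀ : MIso F ((A ⊕ C) ⊕ (B ⊕ D)) (S ⊕ T))
    (h₀ : Good M q₀) :
    Nat.card {q : MIso F ((A ⊕ C) ⊕ (B ⊕ D)) (S ⊕ T) // Good M q} = Nat.card (HW F A B C D) := by
  symm
  apply Nat.card_congr
  refine Equiv.subtypeEquiv (MIso.rEquiv q₀) ?_
  intro h
  have key : ((sg F A B C D).comp (h.comp (sg F A B C D).symm)).symm =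
      (M.comp (q₀.symm.comp (sg F A B C D).symm)).symm.comp
        (M.comp ((h.comp q₀).symm.comp (sg F A B C D).symm)) := by
    simp only [MIso.symm_comp, MIso.symm_symm, MIso.comp_assoc, MIso.symm_comp_cancel,
      MIso.symm_comp_cancel']
  have key' : (M.comp ((h.comp q₀).symm.comp (sg F A B C D).symm)) =
      (M.comp (q₀.symm.comp (sg F A B C D).symm)).comp
        ((sg F A B C D).comp (h.comp (sg F A B C D).symm)).symm := by
    simp only [MIso.symm_comp, MIso.symm_symm, MIso.comp_assoc, MIso.symm_comp_cancel,
      MIso.symm_comp_cancel']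
  constructor
  · rintro ⟨h1, h2⟩
    refine ⟨h1.comp h₀.1, ?_⟩
    change (M.comp ((h.comp q₀).symm.comp (sg F A B C D).symm)).Upper
    rw [key']
    exact h₀.2.comp h2.symm
  · rintro ⟨h1, h2⟩
    refine ⟨?_, ?_⟩
    · have := h1.comp h₀.1.symm
      rwa [show (MIso.rEquiv q₀) h = h.comp q₀ from rfl, MIso.comp_symm_cancel] at this
    · have : ((sg F A B C D).comp (h.comp (sg F A B C D).symm)).symm.Upper := by
        rw [key]
        exact h₀.2.symm.comp h2
      exact this.symm

theorem good_rank (M : MIso F (N₁ ⊕ N₂) (S ⊕ T)) (q : MIso F ((A ⊕ C) ⊕ (B ⊕ D)) (S ⊕ T))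
    (h : Good M q) : M.m.toBlocks₂₁.rank = Fintype.card C := by
  obtain ⟨h1, h2⟩ := h
  set p := M.comp (q.symm.comp (sg F A B C D).symm) with hp
  have hM : M.m = p.m * ((sg F A B C D).m * q.m) := by
    have : p.comp ((sg F A B C D).comp q) = M := by
      rw [hp]
      simp only [MIso.comp_assoc, MIso.symm_comp_cancel]
      rw [← MIso.comp_assoc, MIso.comp_symm_cancel']
    rw [← this]; rfl
  let w : Matrix (C ⊕ D) (A ⊕ C) F := Matrix.fromBlocks 0 1 0 0
  have hw : (sg F A B C D).m.toBlocks₂₁ = w := by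
    ext (i | i) (j | j) <;> simp [sg, MIso.ofEquiv, w, Matrix.toBlocks₂₁, Matrix.one_apply]
  have e1 : M.m.toBlocks₂₁ = p.m.toBlocks₂₂ * (w * q.m.toBlocks₁₁) := by
    rw [hM, tb21, tb21, hw, h2.1, h1.1]
    simp
  have i1 := (p.d2 h2).im
  have i2 := (q.d1 h1).mi
  have e2 : w = p.i.toBlocks₂₂ * M.m.toBlocks₂₁ * q.i.toBlocks₁₁ := by
    rw [e1]
    simp only [MIso.d2, MIso.d1] at i1 i2
    rw [← Matrix.mul_assoc, i1, Matrix.one_mul, Matrix.mul_assoc, i2, Matrix.mul_one]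
  have r1 : M.m.toBlocks₂₁.rank = w.rank := by
    apply le_antisymm
    · rw [e1]
      exact (Matrix.rank_mul_le_right _ _).trans (Matrix.rank_mul_le_left _ _)
    · rw [e2]
      exact (Matrix.rank_mul_le_left _ _).trans (Matrix.rank_mul_le_right _ _)
  rw [r1]
  apply le_antisymm
  · have : w = (Matrix.fromRows 1 0 : Matrix (C ⊕ D) C F) * (Matrix.fromCols 0 1 : Matrix C (A ⊕ C) F) := by
      ext (i | i) (j | j) <;> simp [w]
    rw [this]
    exact (Matrix.rank_mul_le_right _ _).trans (Matrix.rank_le_card_height _)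
  · have : (1 : Matrix C C F) = (Matrix.fromCols 1 0 : Matrix C (C ⊕ D) F) * w *
        (Matrix.fromRows 0 1 : Matrix (A ⊕ C) C F) := by
      have e3 : w = (Matrix.fromRows 1 0 : Matrix (C ⊕ D) C F) * (Matrix.fromCols 0 1 : Matrix C (A ⊕ C) F) := by
        ext (i | i) (j | j) <;> simp [w]
      rw [e3, ← Matrix.mul_assoc, Matrix.fromCols_mul_fromRows, Matrix.mul_assoc,
        Matrix.fromCols_mul_fromRows]
      simp
    calc Fintype.card C = (1 : Matrix C C F).rank := (Matrix.rank_one).symm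
      _ ≤ w.rank := by
        rw [this]
        exact (Matrix.rank_mul_le_left _ _).trans (Matrix.rank_mul_le_right _ _)

end Count

section Bruhat

theorem exists_rel_compl {V : Type} [AddCommGroup V] [Module F V] (A U : Submodule F V)
    (h : A ≤ U) : ∃ C : Submodule F V, A ⊔ C = U ∧ Disjoint A C := by
  obtain ⟨C', hC'⟩ := Submodule.exists_isCompl A
  refine ⟨C' ⊓ U, ?_, ?_⟩
  · rw [← sup_inf_assoc_of_le C' h, hC'.sup_eq_top, top_inf_eq]
  · exact hC'.disjoint.mono_right inf_le_left

theorem adapted {V : Type} [AddCommGroup V] [Module F V] [FiniteDimensional F V]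
    (U W : Submodule F V) : ∃ a b c d : ℕ,
    ∃ β : Module.Basis ((Fin a ⊕ Fin c) ⊕ (Fin b ⊕ Fin d)) F V,
      (∀ x, β (Sum.inl x) ∈ U) ∧ (∀ x, β (Sum.inl (Sum.inl x)) ∈ W) ∧
      (∀ x, β (Sum.inr (Sum.inl x)) ∈ W) ∧
      (∀ v ∈ U, ∀ x, β.repr v (Sum.inr x) = 0) ∧
      (∀ v ∈ W, ∀ x, β.repr v (Sum.inl (Sum.inr x)) = 0) ∧
      (∀ v ∈ W, ∀ x, β.repr v (Sum.inr (Sum.inr x)) = 0) := by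
  obtain ⟨C, hC, hC'⟩ := exists_rel_compl (U ⊓ W) U inf_le_left
  obtain ⟨B, hB, hB'⟩ := exists_rel_compl (U ⊓ W) W inf_le_right
  obtain ⟨D, hD⟩ := Submodule.exists_isCompl (U ⊔ W)
  have hCU : C ≤ U := hC ▸ le_sup_right
  have hBW : B ≤ W := hB ▸ le_sup_right
  let φ : ((↥(U ⊓ W) × C) × (B × D)) →ₗ[F] V :=
    ((U ⊓ W).subtype.coprod C.subtype).coprod (B.subtype.coprod D.subtype)
  have hφ : ∀ p, φ p = ((p.1.1 : V) + p.1.2) + (p.2.1 + p.2.2) := fun p => rfl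
  have hinj : Function.Injective φ := by
    rw [← LinearMap.ker_eq_bot, LinearMap.ker_eq_bot']
    rintro ⟨⟨α, γ⟩, ⟨b, δ⟩⟩ h
    rw [hφ] at h
    simp only at h
    have hUW : (α : V) + γ + b ∈ U ⊔ W :=
      Submodule.add_mem_sup (U.add_mem α.2.1 (hCU γ.2)) (hBW b.2)
    have hδ : (δ : V) = 0 := by
      have h1 : (δ : V) ∈ U ⊔ W := by
        have : (δ : V) = -((α : V) + γ + b) := by
          rw [eq_neg_iff_add_eq_zero, ← h]; abel
        rw [this]
        exact neg_mem hUW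
      exact Submodule.disjoint_def.1 hD.disjoint _ h1 δ.2
    rw [hδ, add_zero] at h
    have hb : (b : V) = 0 := by
      have h1 : (b : V) ∈ U := by
        have : (b : V) = -((α : V) + γ) := by
          rw [eq_neg_iff_add_eq_zero, ← h]; abel
        rw [this]
        exact neg_mem (U.add_mem α.2.1 (hCU γ.2))
      exact Submodule.disjoint_def.1 hB' _ ⟨h1, hBW b.2⟩ b.2
    rw [hb, add_zero] at h
    have hγ : (γ : V) = 0 := by
      have : (γ : V) = -(α : V) := by
        rw [eq_neg_iff_add_eq_zero, ← h]; abel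
      refine Submodule.disjoint_def.1 hC' _ ?_ γ.2
      rw [this]
      exact neg_mem α.2
    rw [hγ, add_zero] at h
    ext <;> simp [h, hγ, hb, hδ]
  have hU : ∀ v ∈ U, ∃ α γ, φ ((α, γ), 0) = v := by
    intro v hv
    rw [← hC] at hv
    obtain ⟨α, hα, γ, hγ, rfl⟩ := Submodule.mem_sup.1 hv
    exact ⟨⟨α, hα⟩, ⟨γ, hγ⟩, by simp [hφ]⟩
  have hW : ∀ v ∈ W, ∃ α b, φ ((α, 0), (b, 0)) = v := by
    intro v hv
    rw [← hB] at hv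
    obtain ⟨α, hα, γ, hγ, rfl⟩ := Submodule.mem_sup.1 hv
    exact ⟨⟨α, hα⟩, ⟨γ, hγ⟩, by simp [hφ]⟩
  have hsurj : Function.Surjective φ := by
    intro v
    have : v ∈ (U ⊔ W) ⊔ D := by rw [hD.sup_eq_top]; trivial
    obtain ⟨x, hx, δ, hδ, rfl⟩ := Submodule.mem_sup.1 this
    obtain ⟨u, hu, w, hw, rfl⟩ := Submodule.mem_sup.1 hx
    obtain ⟨α, γ, rfl⟩ := hU u hu
    obtain ⟨α', b, rfl⟩ := hW w hw
    refine ⟨((α, γ), 0) + ((α', 0), (b, 0)) + ((0, 0), (0, ⟨δ, hδ⟩)), ?_⟩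
    rw [map_add, map_add]
    simp [hφ]
  let θ := LinearEquiv.ofBijective φ ⟨hinj, hsurj⟩
  have hθ : ∀ p, θ p = φ p := fun p => rfl
  refine ⟨_, _, _, _, (((Module.finBasis F ↥(U ⊓ W)).prod (Module.finBasis F C)).prod
    ((Module.finBasis F B).prod (Module.finBasis F D))).map θ, ?_, ?_, ?_, ?_, ?_, ?_⟩
  · rintro (x | x)
    · simp [hθ, hφ]
      exact (Module.finBasis F ↥(U ⊓ W) x).2.1
    · simp [hθ, hφ]
      exact hCU (Module.finBasis F C x).2
  · intro x
    simp [hθ, hφ]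
    exact (Module.finBasis F ↥(U ⊓ W) x).2.2
  · intro x
    simp [hθ, hφ]
    exact hBW (Module.finBasis F B x).2
  · intro v hv x
    obtain ⟨α, γ, rfl⟩ := hU v hv
    rw [← hθ]
    rcases x with x | x <;> simp
  · intro v hv x
    obtain ⟨α, γ, rfl⟩ := hW v hv
    rw [← hθ]
    simp
  · intro v hv x
    obtain ⟨α, γ, rfl⟩ := hW v hv
    rw [← hθ]
    simp

variable {S T N₁ N₂ : Type} [Fintype S] [Fintype T] [Fintype N₁] [Fintype N₂]
  [DecidableEq S] [DecidableEq T] [DecidableEq N₁] [DecidableEq N₂]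

theorem bruhat (M : MIso F (N₁ ⊕ N₂) (S ⊕ T)) : ∃ a b c d : ℕ,
    ∃ q : MIso F ((Fin a ⊕ Fin c) ⊕ (Fin b ⊕ Fin d)) (S ⊕ T), Good M q := by
  let U : Submodule F (S ⊕ T → F) := LinearMap.ker (LinearMap.funLeft F F (Sum.inr : T → S ⊕ T))
  have hU : ∀ v, v ∈ U ↔ ∀ t, v (Sum.inr t) = 0 := by
    intro v
    simp only [U, LinearMap.mem_ker]
    exact ⟨fun h t => congrFun h t, fun h => funext h⟩
  let W : Submodule F (S ⊕ T → F) := LinearMap.ker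
    ((LinearMap.funLeft F F (Sum.inr : N₂ → N₁ ⊕ N₂)) ∘ₗ Matrix.mulVecLin M.m)
  have hW : ∀ v, v ∈ W ↔ ∀ t, (M.m *ᵥ v) (Sum.inr t) = 0 := by
    intro v
    simp only [W, LinearMap.mem_ker]
    exact ⟨fun h t => congrFun h t, fun h => funext h⟩
  obtain ⟨a, b, c, d, β, h1, h2, h3, h4, h5, h6⟩ := adapted U W
  let e := Pi.basisFun F (S ⊕ T)
  let q : MIso F ((Fin a ⊕ Fin c) ⊕ (Fin b ⊕ Fin d)) (S ⊕ T) :=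
    ⟨β.toMatrix e, e.toMatrix β, Module.Basis.toMatrix_mul_toMatrix_flip _ _,
      Module.Basis.toMatrix_mul_toMatrix_flip _ _⟩
  have hqi : ∀ v x, q.i v x = β x v := by
    intro v x
    simp [q, Module.Basis.toMatrix_apply, e]
  have hMqi : ∀ n x, (M.m * q.i) n x = (M.m *ᵥ β x) n := by
    intro n x
    simp [Matrix.mul_apply, Matrix.mulVec, dotProduct, hqi]
  have hqM : ∀ n x, (q.m * M.i) x n = β.repr (fun v => M.i v n) x := by
    intro n x
    have : (fun v => M.i v n) = ∑ v, M.i v n • e v := by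
      ext v
      simp [e, Finset.sum_apply, Pi.single_apply]
    rw [this, map_sum, Finsupp.finsetSum_apply]
    simp [Matrix.mul_apply, q, Module.Basis.toMatrix_apply, mul_comm]
  have hMW : ∀ n, (fun v => M.i v (Sum.inl n)) ∈ W := by
    intro n
    rw [hW]
    intro t
    have := congrFun (congrFun M.mi (Sum.inr t)) (Sum.inl n)
    simpa [Matrix.mul_apply, Matrix.mulVec, dotProduct] using this
  refine ⟨a, b, c, d, q, ⟨?_, ?_⟩, ?_, ?_⟩
  · ext x s
    refine h4 _ ?_ x
    rw [hU]
    intro t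
    simp [e]
  · ext t x
    change q.i (Sum.inr t) (Sum.inl x) = 0
    rw [hqi]
    exact (hU _).1 (h1 x) t
  · have : (M.comp (q.symm.comp (sg F (Fin a) (Fin b) (Fin c) (Fin d)).symm)).m =
        (M.m * q.i).submatrix id (Equiv.sumSumSumComm _ _ _ _).symm := by
      ext i j
      simp [MIso.comp, MIso.symm, sg, MIso.ofEquiv, ← Matrix.mul_assoc]
      simp [Matrix.mul_apply, Matrix.one_apply]
    rw [this]
    ext n x
    rcases x with x | x
    · change (M.m * q.i) (Sum.inr n) (Sum.inl (Sum.inl x)) = 0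
      rw [hMqi]
      exact (hW _).1 (h2 x) n
    · change (M.m * q.i) (Sum.inr n) (Sum.inr (Sum.inl x)) = 0
      rw [hMqi]
      exact (hW _).1 (h3 x) n
  · have : (M.comp (q.symm.comp (sg F (Fin a) (Fin b) (Fin c) (Fin d)).symm)).i =
        (q.m * M.i).submatrix (Equiv.sumSumSumComm _ _ _ _).symm id := by
      ext i j
      simp [MIso.comp, MIso.symm, sg, MIso.ofEquiv, Matrix.mul_assoc]
      simp [Matrix.mul_apply, Matrix.one_apply]
    rw [this]
    ext x n
    rcases x with x | x
    · change (q.m * M.i) (Sum.inl (Sum.inr x)) (Sum.inl n) = 0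
      rw [hqM]
      exact h5 _ (hMW n) x
    · change (q.m * M.i) (Sum.inr (Sum.inr x)) (Sum.inl n) = 0
      rw [hqM]
      exact h6 _ (hMW n) x

end Bruhat

section Core

variable {X₁ X₂ Y₁ Y₂ : Type} [Fintype X₁] [Fintype X₂] [Fintype Y₁] [Fintype Y₂]
  [DecidableEq X₁] [DecidableEq X₂] [DecidableEq Y₁] [DecidableEq Y₂]

/-- extension by zero of a function of the diagonal blocks -/
noncomputable def Phi (h : Matrix X₁ X₁ F → Matrix X₂ X₂ F → ℂ)
    (y : Matrix (X₁ ⊕ X₂) (X₁ ⊕ X₂) F) : ℂ :=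
  if y.toBlocks₂₁ = 0 then h y.toBlocks₁₁ y.toBlocks₂₂ else 0

theorem cj_tb21 (p : MIso F (X₁ ⊕ X₂) (Y₁ ⊕ Y₂)) (hp : p.Upper)
    (y : Matrix (Y₁ ⊕ Y₂) (Y₁ ⊕ Y₂) F) (hy : y.toBlocks₂₁ = 0) : (p.cj y).toBlocks₂₁ = 0 := by
  simp [MIso.cj, tb21, hp.1, hp.2, hy]

theorem cj_symm (p : MIso F (X₁ ⊕ X₂) (Y₁ ⊕ Y₂)) (y : Matrix (Y₁ ⊕ Y₂) (Y₁ ⊕ Y₂) F) :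
    p.symm.cj (p.cj y) = y := by
  simp only [MIso.cj, MIso.symm]
  rw [← Matrix.mul_assoc, ← Matrix.mul_assoc, p.im, Matrix.one_mul, Matrix.mul_assoc, p.im,
    Matrix.mul_one]

theorem Phi_cj (p : MIso F (X₁ ⊕ X₂) (Y₁ ⊕ Y₂)) (hp : p.Upper)
    (h : Matrix X₁ X₁ F → Matrix X₂ X₂ F → ℂ) (h' : Matrix Y₁ Y₁ F → Matrix Y₂ Y₂ F → ℂ)
    (hh : ∀ (l : MIso F X₁ Y₁) (k : MIso F X₂ Y₂) x y, h (l.cj x) (k.cj y) = h' x y)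
    (y : Matrix (Y₁ ⊕ Y₂) (Y₁ ⊕ Y₂) F) : Phi h (p.cj y) = Phi h' y := by
  unfold Phi
  by_cases hy : y.toBlocks₂₁ = 0
  · rw [if_pos hy, if_pos (cj_tb21 p hp y hy), ← hh (p.d1 hp) (p.d2 hp)]
    congr 1
    · simp [MIso.cj, tb11, tb12, tb21, hp.1, hp.2, hy, MIso.d1]
    · simp [MIso.cj, tb11, tb12, tb21, tb22, hp.1, hp.2, hy, MIso.d2]
  · rw [if_neg hy, if_neg]
    intro h0
    apply hy
    have := cj_tb21 p.symm hp.symm _ h0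
    rwa [cj_symm] at this

variable {A B C D : Type} [Fintype A] [Fintype B] [Fintype C] [Fintype D]
  [DecidableEq A] [DecidableEq B] [DecidableEq C] [DecidableEq D]
variable {S T N₁ N₂ : Type} [Fintype S] [Fintype T] [Fintype N₁] [Fintype N₂]
  [DecidableEq S] [DecidableEq T] [DecidableEq N₁] [DecidableEq N₂]

theorem card_upper_right (e₁ : MIso F Y₁ X₁) (e₂ : MIso F Y₂ X₂) :
    Nat.card {p : MIso F (X₁ ⊕ X₂) (Y₁ ⊕ Y₂) // p.Upper} = UC F X₁ X₂ := by
  apply Nat.card_congr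
  refine Equiv.subtypeEquiv (MIso.rEquiv (MIso.mk3 e₁ e₂ 0)) ?_
  intro p
  constructor
  · intro hp
    exact hp.comp (MIso.mk3_upper _ _ _)
  · intro hp
    have := MIso.Upper.comp hp (MIso.mk3_upper e₁ e₂ 0).symm
    rwa [show (MIso.rEquiv (MIso.mk3 e₁ e₂ 0)) p = p.comp _ from rfl,
      MIso.comp_symm_cancel] at this

theorem Phi_good (M : MIso F (N₁ ⊕ N₂) (S ⊕ T)) (q : MIso F ((A ⊕ C) ⊕ (B ⊕ D)) (S ⊕ T))
    (hM : Good M q) (h : Matrix N₁ N₁ F → Matrix N₂ N₂ F → ℂ)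
    (h' : Matrix (A ⊕ B) (A ⊕ B) F → Matrix (C ⊕ D) (C ⊕ D) F → ℂ)
    (hh : ∀ (l : MIso F N₁ (A ⊕ B)) (k : MIso F N₂ (C ⊕ D)) x y, h (l.cj x) (k.cj y) = h' x y)
    (z : Matrix (S ⊕ T) (S ⊕ T) F) :
    Phi h (M.cj z) = Phi h' ((sg F A B C D).cj (q.cj z)) := by
  have : (M.comp (q.symm.comp (sg F A B C D).symm)).comp ((sg F A B C D).comp q) = M := by
    simp only [MIso.comp_assoc, MIso.symm_comp_cancel]
    rw [← MIso.comp_assoc, MIso.comp_symm_cancel']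
  rw [← Phi_cj _ hM.2 h h' hh, ← MIso.cj_comp, ← MIso.cj_comp, MIso.comp_assoc]
  rw [this]

theorem Phi_sg (h' : Matrix (A ⊕ B) (A ⊕ B) F → Matrix (C ⊕ D) (C ⊕ D) F → ℂ)
    (x : Matrix (A ⊕ C) (A ⊕ C) F) (u : Matrix (A ⊕ C) (B ⊕ D) F) (y : Matrix (B ⊕ D) (B ⊕ D) F) :
    Phi h' ((sg F A B C D).cj (Matrix.fromBlocks x u 0 y)) =
      if x.toBlocks₂₁ = 0 then if y.toBlocks₂₁ = 0 then if u.toBlocks₂₁ = 0 then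
        h' (Matrix.fromBlocks x.toBlocks₁₁ u.toBlocks₁₁ 0 y.toBlocks₁₁)
          (Matrix.fromBlocks x.toBlocks₂₂ u.toBlocks₂₂ 0 y.toBlocks₂₂) else 0 else 0 else 0 := by
  unfold Phi sg
  rw [MIso.ofEquiv_cj, sh21, sh11, sh22]
  by_cases h1 : x.toBlocks₂₁ = 0 <;> by_cases h2 : y.toBlocks₂₁ = 0 <;>
    by_cases h3 : u.toBlocks₂₁ = 0 <;> simp [fb_zero, h1, h2, h3]

/-- The contribution of a relative position. -/
noncomputable def Tm (h' : Matrix (A ⊕ B) (A ⊕ B) F → Matrix (C ⊕ D) (C ⊕ D) F → ℂ)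
    (x : Matrix S S F) (y : Matrix T T F) : ℂ :=
  ∑ l : MIso F (A ⊕ C) S, Phi (fun x₁ x₂ => ∑ k : MIso F (B ⊕ D) T, Phi (fun y₁ y₂ =>
    ∑ u₁ : Matrix A B F, ∑ u₂ : Matrix C D F,
      h' (Matrix.fromBlocks x₁ u₁ 0 y₁) (Matrix.fromBlocks x₂ u₂ 0 y₂)) (k.cj y)) (l.cj x)

theorem sum_Phi_sg (h' : Matrix (A ⊕ B) (A ⊕ B) F → Matrix (C ⊕ D) (C ⊕ D) F → ℂ)
    (x : Matrix (A ⊕ C) (A ⊕ C) F) (y : Matrix (B ⊕ D) (B ⊕ D) F) :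
    ∑ u : Matrix (A ⊕ C) (B ⊕ D) F, Phi h' ((sg F A B C D).cj (Matrix.fromBlocks x u 0 y)) =
      (Fintype.card F : ℂ) ^ (Fintype.card A * Fintype.card D) *
      Phi (fun x₁ x₂ => Phi (fun y₁ y₂ => ∑ u₁ : Matrix A B F, ∑ u₂ : Matrix C D F,
      h' (Matrix.fromBlocks x₁ u₁ 0 y₁) (Matrix.fromBlocks x₂ u₂ 0 y₂)) y) x := by
  simp only [Phi_sg]
  by_cases h1 : x.toBlocks₂₁ = 0 <;> by_cases h2 : y.toBlocks₂₁ = 0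
  · simp only [h1, h2, if_true, Phi]
    exact sum_blocks (fun u₁ u₂ => h' (Matrix.fromBlocks x.toBlocks₁₁ u₁ 0 y.toBlocks₁₁)
          (Matrix.fromBlocks x.toBlocks₂₂ u₂ 0 y.toBlocks₂₂))
  all_goals simp [h1, h2, Phi]

theorem core (h : Matrix N₁ N₁ F → Matrix N₂ N₂ F → ℂ)
    (h' : Matrix (A ⊕ B) (A ⊕ B) F → Matrix (C ⊕ D) (C ⊕ D) F → ℂ)
    (hh : ∀ (l : MIso F N₁ (A ⊕ B)) (k : MIso F N₂ (C ⊕ D)) x y, h (l.cj x) (k.cj y) = h' x y)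
    (e₁ : MIso F (A ⊕ B) N₁) (e₂ : MIso F (C ⊕ D) N₂)
    (x : Matrix S S F) (y : Matrix T T F) :
    ∑ u : Matrix S T F, ∑ M : MIso F (N₁ ⊕ N₂) (S ⊕ T),
      (Nat.card {q : MIso F ((A ⊕ C) ⊕ (B ⊕ D)) (S ⊕ T) // Good M q} : ℂ) *
        Phi h (M.cj (Matrix.fromBlocks x u 0 y)) =
    (UC F N₁ N₂ : ℂ) * (Fintype.card F : ℂ) ^ (Fintype.card (A ⊕ C) * Fintype.card T) *
      (Fintype.card F : ℂ) ^ (Fintype.card A * Fintype.card D) * Tm h' x y := by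
  have s1 : ∀ (u : Matrix S T F) (M : MIso F (N₁ ⊕ N₂) (S ⊕ T)),
      (Nat.card {q : MIso F ((A ⊕ C) ⊕ (B ⊕ D)) (S ⊕ T) // Good M q} : ℂ) *
        Phi h (M.cj (Matrix.fromBlocks x u 0 y)) =
      ∑ q : {q : MIso F ((A ⊕ C) ⊕ (B ⊕ D)) (S ⊕ T) // q.Upper},
        if (M.comp (q.1.symm.comp (sg F A B C D).symm)).Upper then
          Phi h' ((sg F A B C D).cj (q.1.cj (Matrix.fromBlocks x u 0 y))) else 0 := by
    intro u M
    have : (Nat.card {q : MIso F ((A ⊕ C) ⊕ (B ⊕ D)) (S ⊕ T) // Good M q} : ℂ) =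
        ∑ q : {q : MIso F ((A ⊕ C) ⊕ (B ⊕ D)) (S ⊕ T) // q.Upper},
        if (M.comp (q.1.symm.comp (sg F A B C D).symm)).Upper then 1 else 0 := by
      rw [Finset.sum_boole, ← Fintype.card_subtype, ← Nat.card_eq_fintype_card]
      congr 1
      exact (Nat.card_congr (Equiv.subtypeSubtypeEquivSubtypeInter
        (fun q : MIso F ((A ⊕ C) ⊕ (B ⊕ D)) (S ⊕ T) => q.Upper)
        (fun q => (M.comp (q.symm.comp (sg F A B C D).symm)).Upper))).symm
    rw [this, Finset.sum_mul]
    apply Finset.sum_congr rfl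
    intro q _
    split_ifs with hq
    · rw [one_mul]
      exact Phi_good M q.1 ⟨q.2, hq⟩ h h' hh _
    · rw [zero_mul]
  simp only [s1]
  have s2 : ∀ q : {q : MIso F ((A ⊕ C) ⊕ (B ⊕ D)) (S ⊕ T) // q.Upper}, ∀ r : ℂ,
      ∑ M : MIso F (N₁ ⊕ N₂) (S ⊕ T), (if (M.comp (q.1.symm.comp (sg F A B C D).symm)).Upper then
        r else 0) = UC F N₁ N₂ * r := by
    intro q r
    rw [← Finset.sum_filter, Finset.sum_const, nsmul_eq_mul, ← Fintype.card_subtype,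
      ← Nat.card_eq_fintype_card, ← card_upper_right e₁ e₂]
    congr 2
    exact Nat.card_congr (Equiv.subtypeEquiv (MIso.rEquiv (q.1.symm.comp (sg F A B C D).symm))
      (fun _ => Iff.rfl))
  have s3 : ∀ u : Matrix S T F, ∑ M : MIso F (N₁ ⊕ N₂) (S ⊕ T),
      ∑ q : {q : MIso F ((A ⊕ C) ⊕ (B ⊕ D)) (S ⊕ T) // q.Upper},
        (if (M.comp (q.1.symm.comp (sg F A B C D).symm)).Upper then
          Phi h' ((sg F A B C D).cj (q.1.cj (Matrix.fromBlocks x u 0 y))) else 0) =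
      ∑ q : {q : MIso F ((A ⊕ C) ⊕ (B ⊕ D)) (S ⊕ T) // q.Upper},
        (UC F N₁ N₂ : ℂ) * Phi h' ((sg F A B C D).cj (q.1.cj (Matrix.fromBlocks x u 0 y))) := by
    intro u
    rw [Finset.sum_comm]
    exact Finset.sum_congr rfl fun q _ => s2 q _
  simp only [s3]
  rw [Finset.sum_comm]
  simp only [← Finset.mul_sum]
  rw [mul_assoc, mul_assoc]
  congr 1
  rw [← Fintype.sum_equiv upperEquiv.symm (fun p : (MIso F (A ⊕ C) S × MIso F (B ⊕ D) T) ×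
      Matrix (A ⊕ C) T F => ∑ u : Matrix S T F,
      Phi h' ((sg F A B C D).cj ((MIso.mk3 p.1.1 p.1.2 p.2).cj (Matrix.fromBlocks x u 0 y))))
      _ (fun p => rfl)]
  have s4 : ∀ p : (MIso F (A ⊕ C) S × MIso F (B ⊕ D) T) × Matrix (A ⊕ C) T F,
      ∑ u : Matrix S T F,
      Phi h' ((sg F A B C D).cj ((MIso.mk3 p.1.1 p.1.2 p.2).cj (Matrix.fromBlocks x u 0 y))) =
      (Fintype.card F : ℂ) ^ (Fintype.card A * Fintype.card D) *
      Phi (fun x₁ x₂ => Phi (fun y₁ y₂ => ∑ u₁ : Matrix A B F, ∑ u₂ : Matrix C D F,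
      h' (Matrix.fromBlocks x₁ u₁ 0 y₁) (Matrix.fromBlocks x₂ u₂ 0 y₂)) (p.1.2.cj y))
        (p.1.1.cj x) := by
    intro p
    rw [← sum_Phi_sg]
    exact sum_mk3_cj p.1.1 p.1.2 p.2 x y (fun z => Phi h' ((sg F A B C D).cj z))
  simp only [s4]
  rw [Fintype.sum_prod_type]
  simp only [Finset.sum_const, Finset.card_univ, nsmul_eq_mul, card_mat]
  rw [← Finset.mul_sum, ← Finset.mul_sum]
  push_cast
  congr 2
  rw [Fintype.sum_prod_type]
  unfold Tm
  apply Finset.sum_congr rfl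
  intro l _
  unfold Phi
  split_ifs <;> simp

end Core

section Bridge

/-- general linear group elements as isomorphisms -/
def glEquiv (n : ℕ) : Matrix.GeneralLinearGroup (Fin n) F ≃ MIso F (Fin n) (Fin n) where
  toFun g := ⟨(g : Matrix (Fin n) (Fin n) F),
    ((g⁻¹ : Matrix.GeneralLinearGroup (Fin n) F) : Matrix (Fin n) (Fin n) F),
    g.mul_inv, g.inv_mul⟩
  invFun M := ⟨M.m, M.i, M.mi, M.im⟩
  left_inv g := Units.ext rfl
  right_inv M := MIso.ext' rfl

theorem conjM_eq {n : ℕ} (g : Matrix.GeneralLinearGroup (Fin n) F) (x : gl F n) :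
    conjM g x = (glEquiv n g).cj x := rfl

theorem upper_of_m {X₁ X₂ : Type} [Fintype X₁] [Fintype X₂] [DecidableEq X₁] [DecidableEq X₂]
    (M : MIso F (X₁ ⊕ X₂) (X₁ ⊕ X₂)) (h : M.m.toBlocks₂₁ = 0) : M.Upper := by
  refine ⟨h, ?_⟩
  have h1 : M.m.toBlocks₂₂ * M.i.toBlocks₂₂ = 1 := by
    have := congrArg Matrix.toBlocks₂₂ M.mi
    simpa [tb22, h, tb22_one] using this
  have h2 : M.m.toBlocks₂₂ * M.i.toBlocks₂₁ = 0 := by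
    have := congrArg Matrix.toBlocks₂₁ M.mi
    simpa [tb21, h, tb21_one] using this
  have h3 := mul_eq_one_comm.1 h1
  calc M.i.toBlocks₂₁ = (M.i.toBlocks₂₂ * M.m.toBlocks₂₂) * M.i.toBlocks₂₁ := by
        rw [h3, Matrix.one_mul]
    _ = 0 := by rw [Matrix.mul_assoc, h2, Matrix.mul_zero]

theorem Pcard_eq (k l : ℕ) : Pcard F k l = UC F (Fin k) (Fin l) := by
  apply Nat.card_congr
  refine Equiv.subtypeEquiv ((glEquiv (k + l)).trans
    ((MIso.rEquiv (MIso.ofEquiv F finSumFinEquiv.symm).symm).trans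
      (MIso.lEquiv (MIso.ofEquiv F finSumFinEquiv.symm)))) ?_
  intro g
  have e : (((glEquiv (k + l)).trans
    ((MIso.rEquiv (MIso.ofEquiv F finSumFinEquiv.symm).symm).trans
      (MIso.lEquiv (MIso.ofEquiv F finSumFinEquiv.symm)))) g).m = blk k l g :=
    conj_m (finSumFinEquiv.symm) (glEquiv (k + l) g)
  constructor
  · intro h
    apply upper_of_m
    rw [e]
    exact h
  · intro h
    have := h.1
    rw [e] at this
    exact this

theorem HCres_eq (k l : ℕ) (f : gl F (k + l) → ℂ) (p : gl F k × gl F l) :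
    HCres k l f p = ((Fintype.card F : ℂ) ^ (k * l))⁻¹ *
      ∑ u : Matrix (Fin k) (Fin l) F, f (but k l p.1 u p.2) := by
  unfold HCres
  split_ifs with hk hl
  · subst hk
    rw [Fintype.sum_subsingleton _ (0 : Matrix (Fin 0) (Fin l) F)]
    simp only [zero_mul, pow_zero, inv_one, one_mul]
    congr 1
    ext i j
    obtain ⟨i, rfl⟩ := finSumFinEquiv.surjective i
    obtain ⟨j, rfl⟩ := finSumFinEquiv.surjective j
    rcases i with i | i
    · exact i.elim0
    rcases j with j | j
    · exact j.elim0
    have e : ∀ i : Fin l, (finCongr (by omega : l = 0 + l)).symm (finSumFinEquiv (Sum.inr i)) = i := by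
      intro i
      ext
      simp
    simp only [but, castM, Matrix.reindex_apply, Matrix.submatrix_apply, e, Equiv.symm_apply_apply,
      Matrix.fromBlocks_apply₂₂]
  · subst hl
    rw [Fintype.sum_subsingleton _ (0 : Matrix (Fin k) (Fin 0) F)]
    simp only [mul_zero, pow_zero, inv_one, one_mul]
    congr 1
    ext i j
    obtain ⟨i, rfl⟩ := finSumFinEquiv.surjective i
    obtain ⟨j, rfl⟩ := finSumFinEquiv.surjective j
    rcases i with i | i
    swap
    · exact i.elim0
    rcases j with j | j
    swap
    · exact j.elim0
    simp [but, castM]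
    rfl
  · rfl

theorem castM_conj {m n : ℕ} (h : m = n) (g : Matrix.GeneralLinearGroup (Fin m) F) (z : gl F m) :
    ∃ g' : Matrix.GeneralLinearGroup (Fin n) F, castM h (conjM g z) = conjM g' (castM h z) := by
  subst h
  exact ⟨g, rfl⟩

theorem ind_aux (k l : ℕ) (r : ℂ) (h : gl F k × gl F l → ℂ) (z : gl F (k + l))
    (h1 : ∀ m : gl F (k + l), IsBUT k l m) (h2 : ∀ g, h (proj k l (conjM g z)) = r) :
    r = ((Pcard F k l : ℂ))⁻¹ *
      ∑ g : Matrix.GeneralLinearGroup (Fin (k + l)) F,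
        if IsBUT k l (conjM g z) then h (proj k l (conjM g z)) else 0 := by
  simp only [h1, h2, if_true, Finset.sum_const, Finset.card_univ, nsmul_eq_mul]
  have : Pcard F k l = Fintype.card (Matrix.GeneralLinearGroup (Fin (k + l)) F) := by
    unfold Pcard
    rw [← Nat.card_eq_fintype_card]
    exact Nat.card_congr (Equiv.subtypeUnivEquiv (fun g => h1 _))
  rw [this, ← mul_assoc, inv_mul_cancel₀, one_mul]
  exact_mod_cast Fintype.card_ne_zero

theorem HCind_eq' (k l : ℕ) (h : gl F k × gl F l → ℂ) (hh : Invariant₂ k l h) (z : gl F (k + l)) :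
    HCind k l h z = ((Pcard F k l : ℂ))⁻¹ *
      ∑ g : Matrix.GeneralLinearGroup (Fin (k + l)) F,
        if IsBUT k l (conjM g z) then h (proj k l (conjM g z)) else 0 := by
  unfold HCind
  split_ifs with hk hl
  · subst hk
    apply ind_aux
    · intro m
      ext i j
      exact j.elim0
    · intro g
      obtain ⟨g', hg'⟩ := castM_conj (by omega : 0 + l = l) g z
      have e : proj 0 l (conjM g z) = (conjM 1 0, conjM g' (castM (by omega) z)) := by
        rw [← hg']
        refine Prod.ext (Subsingleton.elim _ _) ?_
        ext i j
        simp [proj, blk, castM, Matrix.toBlocks₂₂]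
      rw [e, hh]
  · subst hl
    apply ind_aux
    · intro m
      ext i j
      exact i.elim0
    · intro g
      have e : proj k 0 (conjM g z) = (conjM g z, conjM 1 0) := by
        refine Prod.ext ?_ (Subsingleton.elim _ _)
        ext i j
        rfl
      rw [e]
      exact hh g 1 z 0
  · rfl

theorem HCind_eq (k l : ℕ) (h : gl F k × gl F l → ℂ) (hh : Invariant₂ k l h)
    {X : Type} [Fintype X] [DecidableEq X] (e : X ≃ Fin (k + l)) (z : Matrix X X F) :
    HCind k l h (Matrix.reindex e e z) = ((UC F (Fin k) (Fin l) : ℂ))⁻¹ *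
      ∑ M : MIso F (Fin k ⊕ Fin l) X, Phi (fun x y => h (x, y)) (M.cj z) := by
  rw [HCind_eq' k l h hh, Pcard_eq]
  congr 1
  refine Fintype.sum_equiv ((glEquiv (k + l)).trans
    ((MIso.rEquiv (MIso.ofEquiv F e)).trans
      (MIso.lEquiv (MIso.ofEquiv F finSumFinEquiv.symm)))) _ _ ?_
  intro g
  have : (((glEquiv (k + l)).trans
    ((MIso.rEquiv (MIso.ofEquiv F e)).trans
      (MIso.lEquiv (MIso.ofEquiv F finSumFinEquiv.symm)))) g).cj z =
      blk k l (conjM g (Matrix.reindex e e z)) := by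
    rw [conjM_eq, ← MIso.ofEquiv_cj, ← MIso.cj_comp]
    unfold blk
    rw [← MIso.ofEquiv_cj, ← MIso.cj_comp]
    rfl
  rw [this]
  unfold Phi
  exact if_congr Iff.rfl rfl rfl

end Bridge

section Final

/-- transport of `f` to block matrices -/
noncomputable def tr {a b n : ℕ} (h : a + b = n) (f : gl F n → ℂ)
    (z : Matrix (Fin a ⊕ Fin b) (Fin a ⊕ Fin b) F) : ℂ :=
  f (Matrix.reindex (finSumFinEquiv.trans (finCongr h)) (finSumFinEquiv.trans (finCongr h)) z)

theorem inv_cj {n : ℕ} {f : gl F n → ℂ} (hf : Invariant n f) (L : MIso F (Fin n) (Fin n))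
    (z : gl F n) : f (L.cj z) = f z := by
  have := hf ((glEquiv n).symm L) z
  rwa [conjM_eq, Equiv.apply_symm_apply] at this

theorem tr_cj {a b n : ℕ} (h : a + b = n) {f : gl F n → ℂ} (hf : Invariant n f)
    (L : MIso F (Fin n) (Fin a ⊕ Fin b)) (z : Matrix (Fin a ⊕ Fin b) (Fin a ⊕ Fin b) F) :
    f (L.cj z) = tr h f z := by
  unfold tr
  rw [← MIso.ofEquiv_cj]
  have := inv_cj hf (L.comp (MIso.ofEquiv F (finSumFinEquiv.trans (finCongr h))).symm)
    ((MIso.ofEquiv F (finSumFinEquiv.trans (finCongr h))).cj z)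
  rwa [← MIso.cj_comp, MIso.comp_symm_cancel'] at this

theorem tr_inv {a b n : ℕ} (h : a + b = n) {f : gl F n → ℂ} (hf : Invariant n f)
    (L : MIso F (Fin a ⊕ Fin b) (Fin a ⊕ Fin b)) (z : Matrix (Fin a ⊕ Fin b) (Fin a ⊕ Fin b) F) :
    tr h f (L.cj z) = tr h f z := by
  rw [← tr_cj h hf (MIso.ofEquiv F (finSumFinEquiv.trans (finCongr h))), ← MIso.cj_comp,
    tr_cj h hf]

theorem HCres_tr {a b n : ℕ} (h : a + b = n) (f : gl F n → ℂ) (x : gl F a) (y : gl F b) :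
    HCres a b (castFun h.symm f) (x, y) = ((Fintype.card F : ℂ) ^ (a * b))⁻¹ *
      ∑ u : Matrix (Fin a) (Fin b) F, tr h f (Matrix.fromBlocks x u 0 y) := by
  rw [HCres_eq]
  rfl

theorem HCres_inv {a b n : ℕ} (h : a + b = n) {f : gl F n → ℂ} (hf : Invariant n f)
    (g₁ : Matrix.GeneralLinearGroup (Fin a) F) (g₂ : Matrix.GeneralLinearGroup (Fin b) F)
    (x : gl F a) (y : gl F b) :
    HCres a b (castFun h.symm f) (conjM g₁ x, conjM g₂ y) =
      HCres a b (castFun h.symm f) (x, y) := by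
  rw [HCres_tr h, HCres_tr h]
  congr 1
  rw [conjM_eq, conjM_eq, ← sum_mk3_cj (glEquiv a g₁) (glEquiv b g₂) 0 x y (tr h f)]
  exact Finset.sum_congr rfl fun u _ => tr_inv h hf _ _

theorem conjM_one {n : ℕ} (x : gl F n) : conjM 1 x = x := by
  simp [conjM]

/-- The right-hand side term. -/
theorem rhs_term {n₁ n₂ s t a b c d : ℕ} (hab : a + b = n₁) (hcd : c + d = n₂) (hac : a + c = s)
    (hbd : b + d = t)
    (f : gl F n₁ → ℂ) (g : gl F n₂ → ℂ) (hf : Invariant n₁ f) (hg : Invariant n₂ g)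
    (x : gl F s) (y : gl F t) :
    HCind a c (fun uv => HCind b d (fun wz =>
        HCres a b (castFun hab.symm f) (uv.1, wz.1) *
          HCres c d (castFun hcd.symm g) (uv.2, wz.2)) (castM hbd.symm y)) (castM hac.symm x) =
      (UC F (Fin a) (Fin c) : ℂ)⁻¹ * ((UC F (Fin b) (Fin d) : ℂ)⁻¹ *
        (((Fintype.card F : ℂ) ^ (a * b))⁻¹ * ((Fintype.card F : ℂ) ^ (c * d))⁻¹)) *
        Tm (fun z₁ z₂ => tr hab f z₁ * tr hcd g z₂) x y := by
  unfold castM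
  rw [HCind_eq]
  swap
  · intro g₁ g₂ u v
    simp only
    congr 1
    funext wz
    have e1 := HCres_inv hab hf g₁ 1 u wz.1
    have e2 := HCres_inv hcd hg g₂ 1 v wz.2
    rw [conjM_one] at e1 e2
    rw [e1, e2]
  rw [mul_assoc]
  congr 1
  unfold Tm
  rw [Finset.mul_sum]
  apply Finset.sum_congr rfl
  intro l _
  unfold Phi
  split_ifs with hl
  swap
  · simp
  dsimp only
  rw [HCind_eq]
  swap
  · intro g₁ g₂ u v
    simp only
    have e1 := HCres_inv hab hf 1 g₁ (l.cj x).toBlocks₁₁ u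
    have e2 := HCres_inv hcd hg 1 g₂ (l.cj x).toBlocks₂₂ v
    rw [conjM_one] at e1 e2
    rw [e1, e2]
  rw [mul_assoc]
  congr 1
  rw [Finset.mul_sum]
  apply Finset.sum_congr rfl
  intro k _
  unfold Phi
  split_ifs with hk
  swap
  · simp
  dsimp only
  rw [HCres_tr hab, HCres_tr hcd, mul_mul_mul_comm, Finset.sum_mul_sum]

abbrev Quad (n₁ n₂ s t : ℕ) := {y : Fin (n₁ + n₂ + 1) × Fin (n₁ + n₂ + 1) × Fin (n₁ + n₂ + 1) × Fin (n₁ + n₂ + 1) //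
          (y.1 : ℕ) + (y.2.1 : ℕ) = n₁ ∧ (y.2.2.1 : ℕ) + (y.2.2.2 : ℕ) = n₂ ∧
          (y.1 : ℕ) + (y.2.2.1 : ℕ) = s ∧ (y.2.1 : ℕ) + (y.2.2.2 : ℕ) = t}

noncomputable def cg {n₁ n₂ s t : ℕ} (a b c d : ℕ)
    (M : MIso F (Fin n₁ ⊕ Fin n₂) (Fin s ⊕ Fin t)) : ℂ :=
  (Nat.card {q : MIso F ((Fin a ⊕ Fin c) ⊕ (Fin b ⊕ Fin d)) (Fin s ⊕ Fin t) // Good M q} : ℂ)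

theorem UC_ne (X₁ X₂ : Type) [Fintype X₁] [Fintype X₂] [DecidableEq X₁] [DecidableEq X₂] :
    (UC F X₁ X₂ : ℂ) ≠ 0 := by
  unfold UC
  have : Nonempty {M : MIso F (X₁ ⊕ X₂) (X₁ ⊕ X₂) // M.Upper} :=
    ⟨⟨⟨1, 1, by simp, by simp⟩, tb21_one, tb21_one⟩⟩
  exact_mod_cast Nat.card_pos.ne'

theorem q_ne : (Fintype.card F : ℂ) ≠ 0 := by
  exact_mod_cast Fintype.card_ne_zero

theorem HW_ne (A B C D : Type) [Fintype A] [Fintype B] [Fintype C] [Fintype D]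
    [DecidableEq A] [DecidableEq B] [DecidableEq C] [DecidableEq D] :
    (Nat.card (HW F A B C D) : ℂ) ≠ 0 := by
  rw [card_HW]
  exact mul_ne_zero (mul_ne_zero (UC_ne (F := F) _ _) (UC_ne (F := F) _ _))
    (mul_ne_zero (pow_ne_zero _ (q_ne (F := F)))
      (mul_ne_zero (pow_ne_zero _ (q_ne (F := F))) (pow_ne_zero _ (q_ne (F := F)))))

theorem partition {n₁ n₂ s t : ℕ} (M : MIso F (Fin n₁ ⊕ Fin n₂) (Fin s ⊕ Fin t)) :
    ∑ x : Quad n₁ n₂ s t,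
      (Nat.card (HW F (Fin x.1.1) (Fin x.1.2.1) (Fin x.1.2.2.1) (Fin x.1.2.2.2)) : ℂ)⁻¹ *
        cg x.1.1 x.1.2.1 x.1.2.2.1 x.1.2.2.2 M = 1 := by
  obtain ⟨a, b, c, d, q, hq⟩ := bruhat M
  have h1 := (q.d1 hq.1).card_eq
  have h2 := (q.d2 hq.1).card_eq
  have h3 := (MIso.d1 _ hq.2).card_eq
  have h4 := (MIso.d2 _ hq.2).card_eq
  simp only [Fintype.card_sum, Fintype.card_fin] at h1 h2 h3 h4
  rw [Finset.sum_eq_single (⟨(⟨a, by omega⟩, ⟨b, by omega⟩, ⟨c, by omega⟩, ⟨d, by omega⟩),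
    by simp only; omega⟩ : Quad n₁ n₂ s t)]
  · simp only [cg]
    rw [card_good M q hq]
    exact inv_mul_cancel₀ (HW_ne _ _ _ _)
  · rintro ⟨⟨⟨a', ha⟩, ⟨b', hb⟩, ⟨c', hc⟩, ⟨d', hd⟩⟩, k1, k2, k3, k4⟩ _ hne
    simp only at k1 k2 k3 k4
    simp only [cg]
    have : IsEmpty {q : MIso F ((Fin a' ⊕ Fin c') ⊕ (Fin b' ⊕ Fin d')) (Fin s ⊕ Fin t) // Good M q} := by
      constructor
      rintro ⟨q', hq'⟩
      apply hne
      have r1 := good_rank M q hq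
      have r2 := good_rank M q' hq'
      rw [r1] at r2
      simp only [Fintype.card_fin] at r2
      simp only [Subtype.mk.injEq, Prod.mk.injEq, Fin.mk.injEq]
      omega
    have h0 : Nat.card {q : MIso F ((Fin a' ⊕ Fin c') ⊕ (Fin b' ⊕ Fin d')) (Fin s ⊕ Fin t) //
        Good M q} = 0 := Nat.card_of_isEmpty
    rw [h0]
    simp
  · intro h
    exact absurd (Finset.mem_univ _) h

theorem lhs_eq {n₁ n₂ s t : ℕ} (hst : s + t = n₁ + n₂)
    (f : gl F n₁ → ℂ) (g : gl F n₂ → ℂ) (hf : Invariant n₁ f) (hg : Invariant n₂ g)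
    (x : gl F s) (y : gl F t) :
    HCres s t (castFun hst.symm (HCind n₁ n₂ fun p => f p.1 * g p.2)) (x, y) =
      ((Fintype.card F : ℂ) ^ (s * t))⁻¹ * ((UC F (Fin n₁) (Fin n₂) : ℂ)⁻¹ *
        ∑ u : Matrix (Fin s) (Fin t) F, ∑ M : MIso F (Fin n₁ ⊕ Fin n₂) (Fin s ⊕ Fin t),
          Phi (fun x y => f x * g y) (M.cj (Matrix.fromBlocks x u 0 y))) := by
  rw [HCres_eq]
  congr 1
  rw [Finset.mul_sum]
  apply Finset.sum_congr rfl
  intro u _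
  have hinv : Invariant₂ n₁ n₂ (fun p : gl F n₁ × gl F n₂ => f p.1 * g p.2) := by
    intro g₁ g₂ x y
    simp only
    rw [hf, hg]
  exact HCind_eq n₁ n₂ _ hinv (finSumFinEquiv.trans (finCongr hst)) (Matrix.fromBlocks x u 0 y)

theorem main_aux {n₁ n₂ s t : ℕ} (hst : s + t = n₁ + n₂)
    (f : gl F n₁ → ℂ) (g : gl F n₂ → ℂ) (hf : Invariant n₁ f) (hg : Invariant n₂ g)
    (x : gl F s) (y : gl F t) :
    HCres s t (castFun hst.symm (HCind n₁ n₂ fun p => f p.1 * g p.2)) (x, y) =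
      ∑ w : Quad n₁ n₂ s t,
        HCind w.1.1 w.1.2.2.1 (fun uv => HCind w.1.2.1 w.1.2.2.2 (fun wz =>
          HCres w.1.1 w.1.2.1 (castFun w.2.1.symm f) (uv.1, wz.1) *
            HCres w.1.2.2.1 w.1.2.2.2 (castFun w.2.2.1.symm g) (uv.2, wz.2))
              (castM w.2.2.2.2.symm y)) (castM w.2.2.2.1.symm x) := by
  rw [lhs_eq hst f g hf hg]
  have s1 : ∑ u : Matrix (Fin s) (Fin t) F, ∑ M : MIso F (Fin n₁ ⊕ Fin n₂) (Fin s ⊕ Fin t),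
          Phi (fun x y => f x * g y) (M.cj (Matrix.fromBlocks x u 0 y)) =
      ∑ w : Quad n₁ n₂ s t,
      (Nat.card (HW F (Fin w.1.1) (Fin w.1.2.1) (Fin w.1.2.2.1) (Fin w.1.2.2.2)) : ℂ)⁻¹ *
      ∑ u : Matrix (Fin s) (Fin t) F, ∑ M : MIso F (Fin n₁ ⊕ Fin n₂) (Fin s ⊕ Fin t),
        cg w.1.1 w.1.2.1 w.1.2.2.1 w.1.2.2.2 M *
          Phi (fun x y => f x * g y) (M.cj (Matrix.fromBlocks x u 0 y)) := by
    simp only [Finset.mul_sum]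
    symm
    rw [Finset.sum_comm]
    apply Finset.sum_congr rfl
    intro u _
    rw [Finset.sum_comm]
    apply Finset.sum_congr rfl
    intro M _
    simp only [← mul_assoc]
    rw [← Finset.sum_mul, partition M, one_mul]
  rw [s1, Finset.mul_sum, Finset.mul_sum]
  apply Finset.sum_congr rfl
  rintro ⟨⟨⟨a, ha⟩, ⟨b, hb⟩, ⟨c, hc⟩, ⟨d, hd⟩⟩, hab, hcd, hac, hbd⟩ _
  simp only at hab hcd hac hbd ⊢
  rw [rhs_term hab hcd hac hbd f g hf hg x y]
  unfold cg
  rw [core (A := Fin a) (B := Fin b) (C := Fin c) (D := Fin d) (fun x y => f x * g y)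
    (fun z₁ z₂ => tr hab f z₁ * tr hcd g z₂)
    (fun l k z₁ z₂ => by rw [tr_cj hab hf, tr_cj hcd hg])
    (MIso.ofEquiv F (finSumFinEquiv.trans (finCongr hab))).symm
    (MIso.ofEquiv F (finSumFinEquiv.trans (finCongr hcd))).symm x y]
  rw [card_HW]
  simp only [Fintype.card_sum, Fintype.card_fin, hac]
  have u1 := UC_ne (F := F) (Fin a) (Fin c)
  have u2 := UC_ne (F := F) (Fin b) (Fin d)
  have u3 := UC_ne (F := F) (Fin n₁) (Fin n₂)
  have q1 := pow_ne_zero (s * t) (q_ne (F := F))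
  have q2 := pow_ne_zero (a * b) (q_ne (F := F))
  have q3 := pow_ne_zero (c * d) (q_ne (F := F))
  have q4 := pow_ne_zero (a * d) (q_ne (F := F))
  generalize (Fintype.card F : ℂ) ^ (s * t) = Q1 at *
  generalize (Fintype.card F : ℂ) ^ (a * b) = Q2 at *
  generalize (Fintype.card F : ℂ) ^ (c * d) = Q3 at *
  generalize (Fintype.card F : ℂ) ^ (a * d) = Q4 at *
  field_simp

end Final

/-- bialgebra compatibility of Harish-Chandra induction and restriction. -/
theorem bialgebra_compatibility (F : Type) [Field F] [Fintype F] [DecidableEq F]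
    (n₁ n₂ s t : ℕ) (h₁ : 1 ≤ n₁) (h₂ : 1 ≤ n₂) (hst : s + t = n₁ + n₂)
    (f : gl F n₁ → ℂ) (g : gl F n₂ → ℂ) (hf : Invariant n₁ f) (hg : Invariant n₂ g) :
    HCres s t (castFun hst.symm (HCind n₁ n₂ fun p => f p.1 * g p.2)) =
      ∑ x : {y : Fin (n₁ + n₂ + 1) × Fin (n₁ + n₂ + 1) × Fin (n₁ + n₂ + 1) × Fin (n₁ + n₂ + 1) //
          (y.1 : ℕ) + (y.2.1 : ℕ) = n₁ ∧ (y.2.2.1 : ℕ) + (y.2.2.2 : ℕ) = n₂ ∧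
          (y.1 : ℕ) + (y.2.2.1 : ℕ) = s ∧ (y.2.1 : ℕ) + (y.2.2.2 : ℕ) = t},
        match x with
        | ⟨(a, b, c, d), hab, hcd, hac, hbd⟩ =>
          fun p : gl F s × gl F t =>
            HCind (a : ℕ) (c : ℕ)
              (fun uv => HCind (b : ℕ) (d : ℕ)
                (fun wz =>
                  HCres (a : ℕ) (b : ℕ) (castFun hab.symm f) (uv.1, wz.1) *
                  HCres (c : ℕ) (d : ℕ) (castFun hcd.symm g) (uv.2, wz.2))
                (castM hbd.symm p.2))
              (castM hac.symm p.1) := by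
  funext p
  obtain ⟨x, y⟩ := p
  rw [main_aux hst f g hf hg x y, Finset.sum_apply]
  apply Finset.sum_congr rfl
  rintro ⟨⟨a, b, c, d⟩, hab, hcd, hac, hbd⟩ _
  rfl

end HCPaper
end
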